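/- arXiv:1802.05158 — 3 statements merged into one kernel-verified Lean document; each statement's English description precedes it below -/
import Mathlib

section
/- Let k and p be positive integers. Let G be a graph containing a geodesic cycle C of length at least 4·⌊p/2⌋·k which is the 𝔽₂-sum of a family of cycles of G each of length at most p. Then for every set X ⊆ V(G) of at most k vertices, some connected component of G − X contains at least half of the vertices of C. -/
open SimpleGraph

/-- A closed walk `c` is geodesic: between any two of its vertices it contains a path
whose length is minimum among all paths of `G` between those vertices. -/
def IsGeodesic {V : Type u} {G : SimpleGraph V} {v : V} (c : G.Walk v v) : Prop :=
  ∀ a ∈ c.support, ∀ b ∈ c.support,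
    ∃ p : G.Walk a b, p.IsPath ∧ (∀ e ∈ p.edges, e ∈ c.edges) ∧
      ∀ q : G.Walk a b, q.IsPath → p.length ≤ q.length

namespace SimpleGraph

section Parity

variable {V : Type*} {G : SimpleGraph V}

open Classical in
/-- The indicator modulo two of the edges joining `K` to `Y`. -/
noncomputable def cutIndicator (K Y : Set V) (e : Sym2 V) : ZMod 2 :=
  if ∃ u ∈ K, ∃ x ∈ Y, e = s(u, x) then 1 else 0

theorem sum_cutIndicator_edges_eq_zero {K Y : Set V} {a b : V} (w : G.Walk a b)
    (h : ∀ x ∈ w.support, x ∉ Y) : (w.edges.map (cutIndicator K Y)).sum = 0 := by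
  refine List.sum_eq_zero fun z hz => ?_
  obtain ⟨e, he, rfl⟩ := List.mem_map.1 hz
  refine if_neg ?_
  rintro ⟨u, -, x, hx, rfl⟩
  exact h x (w.snd_mem_support_of_mem_edges he) hx

open Classical in
theorem sum_cutIndicator_edges {K X Y : Set V} (hYX : Y ⊆ X) (hKX : Disjoint K X)
    (hK : ∀ u ∈ K, ∀ x, G.Adj u x → x ∉ X → x ∈ K) {a b : V} (w : G.Walk a b)
    (h : ∀ x ∈ w.support, x ∈ X → x ∈ Y) :
    (w.edges.map (cutIndicator K Y)).sum =
      (if a ∈ K then 1 else 0) + (if b ∈ K then 1 else 0) := by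
  induction w with
  | nil => simp [CharTwo.add_self_eq_zero]
  | @cons a d b had w ih =>
    rw [Walk.edges_cons, List.map_cons, List.sum_cons,
      ih fun x hx => h x (by simp [hx])]
    have ha := h a (by simp)
    have hd := h d (by simp)
    have hedge : cutIndicator K Y s(a, d) =
        (if a ∈ K then 1 else 0) + (if d ∈ K then 1 else 0) := by
      have hdis : ∀ z, z ∈ K → z ∉ X := fun z hz => Set.disjoint_left.1 hKX hz
      have h1 : (∃ u ∈ K, ∃ x ∈ Y, s(a, d) = s(u, x)) ↔ (a ∈ K ∧ d ∈ Y) ∨ (d ∈ K ∧ a ∈ Y) := by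
        simp only [Sym2.eq_iff]
        grind
      have h2 := hK a
      have h3 := hK d
      unfold cutIndicator
      simp only [h1]
      by_cases haK : a ∈ K <;> by_cases hdK : d ∈ K
      · have : ¬ ((a ∈ K ∧ d ∈ Y) ∨ (d ∈ K ∧ a ∈ Y)) := by grind
        rw [if_neg this, if_pos haK, if_pos hdK]
        exact (by decide : (0 : ZMod 2) = 1 + 1)
      · have : d ∈ Y := hd (by_contra fun hX => hdK (h2 haK d had hX))
        simp [haK, hdK, this]
      · have : a ∈ Y := ha (by_contra fun hX => haK (h3 hdK a had.symm hX))
        simp [haK, hdK, this]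
      · simp [haK, hdK]
    rw [hedge]
    have : ∀ x y z : ZMod 2, x + y + (y + z) = x + z := by decide
    exact this _ _ _

theorem sum_map_edges_eq_of_mod_two_sum {v : V} {c : G.Walk v v} (hc : c.IsTrail)
    {ι : Type*} [Fintype ι] {u : ι → V} {D : ∀ i, G.Walk (u i) (u i)}
    (hD : ∀ i, (D i).IsTrail)
    (hsum : ∀ e : Sym2 V, e ∈ c.edges ↔ Odd {i : ι | e ∈ (D i).edges}.ncard)
    (f : Sym2 V → ZMod 2) :
    (c.edges.map f).sum = ∑ i, ((D i).edges.map f).sum := by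
  classical
  let S : Finset (Sym2 V) := c.edges.toFinset ∪ Finset.univ.biUnion fun i => (D i).edges.toFinset
  have key : ∀ {a : V} (w : G.Walk a a), w.IsTrail → w.edges.toFinset ⊆ S →
      (w.edges.map f).sum = ∑ e ∈ S, if e ∈ w.edges then f e else 0 := by
    intro a w hw hS
    rw [← List.sum_toFinset f hw.edges_nodup, ← Finset.sum_filter]
    refine Finset.sum_congr ?_ fun _ _ => rfl
    ext e
    simp only [List.mem_toFinset, Finset.mem_filter]
    exact ⟨fun h => ⟨hS (List.mem_toFinset.2 h), h⟩, fun h => h.2⟩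
  rw [key c hc Finset.subset_union_left]
  rw [Finset.sum_congr rfl fun i _ => key (D i) (hD i)
    (Finset.Subset.trans (Finset.subset_biUnion_of_mem (fun i => (D i).edges.toFinset)
      (Finset.mem_univ i)) Finset.subset_union_right)]
  rw [Finset.sum_comm]
  refine Finset.sum_congr rfl fun e _ => ?_
  rw [← Finset.sum_filter, Finset.sum_const, nsmul_eq_mul]
  have hcard : (Finset.univ.filter fun i => e ∈ (D i).edges).card =
      {i : ι | e ∈ (D i).edges}.ncard := by
    rw [← Set.ncard_coe_finset]
    simp
  rw [hcard]
  by_cases he : e ∈ c.edges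
  · rw [if_pos he, ZMod.natCast_eq_one_iff_odd.2 ((hsum e).1 he), one_mul]
  · rw [if_neg he, ZMod.natCast_eq_zero_iff_even.2
      (Nat.not_odd_iff_even.1 fun h => he ((hsum e).2 h)), zero_mul]

end Parity

section Cycle

variable {V : Type*} {G : SimpleGraph V} {v : V} {c : G.Walk v v}

theorem Walk.IsCycle.exists_getVert_of_walk (hc : c.IsCycle) {y z : V} (q : G.Walk y z)
    (hq : ∀ e ∈ q.edges, e ∈ c.edges) (n : ℕ)
    (hy : ∃ i ≤ c.length, c.getVert i = y ∧ (i ≤ n ∨ c.length ≤ n + i)) :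
    ∃ i ≤ c.length, c.getVert i = z ∧ (i ≤ n + q.length ∨ c.length ≤ n + q.length + i) := by
  induction q generalizing n with
  | nil => simpa using hy
  | @cons y d z h q ih =>
    have key : ∃ i ≤ c.length, c.getVert i = d ∧ (i ≤ n + 1 ∨ c.length ≤ n + 1 + i) := by
      obtain ⟨i, hi, rfl, hin⟩ := hy
      have h3 := hc.three_le_length
      have h0L : c.getVert 0 = c.getVert c.length := by simp
      obtain ⟨j, hj, hjj⟩ := (c.mk_mem_edges_iff_exists).1
        (hq s(c.getVert i, d) (by simp [Walk.edges_cons]))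
      have inj : ∀ s t, 1 ≤ s → s ≤ c.length → 1 ≤ t → t ≤ c.length →
          c.getVert s = c.getVert t → s = t :=
        fun s t hs hs' ht ht' hst => hc.getVert_injOn ⟨hs, hs'⟩ ⟨ht, ht'⟩ hst
      rcases Sym2.eq_iff.1 hjj with ⟨h1, h2⟩ | ⟨h1, h2⟩
      · refine ⟨j + 1, hj, h2, ?_⟩
        rcases Nat.eq_zero_or_pos j with rfl | hj0
        · left; omega
        · rcases Nat.eq_zero_or_pos i with rfl | hi0
          · have := inj j c.length hj0 hj.le (by omega) le_rfl (h1.trans h0L)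
            omega
          · have := inj j i hj0 hj.le hi0 hi h1
            omega
      · refine ⟨j, hj.le, h1, ?_⟩
        rcases Nat.eq_zero_or_pos i with rfl | hi0
        · have := inj (j + 1) c.length (by omega) hj (by omega) le_rfl (h2.trans h0L)
          omega
        · have := inj (j + 1) i (by omega) hj hi0 hi h2
          omega
    obtain ⟨i, hi, hiz, h'⟩ := ih (fun e he => hq e (by simp [Walk.edges_cons, he])) (n + 1) key
    refine ⟨i, hi, hiz, ?_⟩
    rw [Walk.length_cons]
    omega

theorem Walk.IsCycle.ncard_ball_le (hc : c.IsCycle) {y : V} (hy : y ∈ c.support) (R : ℕ) :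
    {z : V | ∃ q : G.Walk y z, (∀ e ∈ q.edges, e ∈ c.edges) ∧ q.length ≤ R}.ncard ≤
      2 * R + 1 := by
  classical
  set c' := c.rotate y hy with hc'def
  have hc' : c'.IsCycle := (Walk.isCycle_rotate hy).2 hc
  let S : Finset V := (Finset.range (R + 1)).image c'.getVert ∪
    (Finset.Ico (c'.length - R) c'.length).image c'.getVert
  have hsub : {z : V | ∃ q : G.Walk y z, (∀ e ∈ q.edges, e ∈ c.edges) ∧ q.length ≤ R} ⊆
      (S : Set V) := by
    rintro z ⟨q, hq, hqR⟩
    obtain ⟨i, hi, rfl, h⟩ := hc'.exists_getVert_of_walk q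
      (fun e he => (c.rotate_edges y hy).mem_iff.2 (hq e he)) 0 ⟨0, by simp⟩
    simp only [S, Finset.coe_union, Finset.coe_image, Set.mem_union, Set.mem_image,
      Finset.mem_coe, Finset.mem_range, Finset.mem_Ico]
    by_cases h1 : i ≤ R
    · exact Or.inl ⟨i, by omega, rfl⟩
    · by_cases h2 : i = c'.length
      · exact Or.inl ⟨0, by omega, by rw [h2]; simp⟩
      · exact Or.inr ⟨i, by omega, rfl⟩
  calc _ ≤ (S : Set V).ncard := Set.ncard_le_ncard hsub S.finite_toSet
    _ = S.card := Set.ncard_coe_finset S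
    _ ≤ _ := Finset.card_union_le _ _
    _ ≤ (R + 1) + (c'.length - (c'.length - R)) := by
        gcongr
        · exact Finset.card_image_le.trans (by simp)
        · exact Finset.card_image_le.trans (by simp)
    _ ≤ 2 * R + 1 := by omega

theorem Walk.IsCycle.ncard_support (hc : c.IsCycle) : {w : V | w ∈ c.support}.ncard = c.length := by
  classical
  have h : {w : V | w ∈ c.support} = (c.support.tail.toFinset : Set V) := by
    ext w
    simp only [Set.mem_ofPred_eq, List.coe_toFinset]
    refine ⟨fun hw => ?_, fun hw => List.mem_of_mem_tail hw⟩
    rcases (Walk.mem_support_iff c).1 hw with rfl | hw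
    · exact Walk.end_mem_tail_support hc.not_nil
    · exact hw
  rw [h, Set.ncard_coe_finset, List.toFinset_card_of_nodup hc.support_nodup]
  simp

/-- Two vertices of a short closed walk are joined by a walk of at most half its length. -/
theorem Walk.exists_walk_length_le_half (c : G.Walk v v) {x y : V} (hx : x ∈ c.support)
    (hy : y ∈ c.support) : ∃ q : G.Walk x y, q.length ≤ c.length / 2 := by
  classical
  have hy' : y ∈ (c.rotate x hx).support := (c.mem_support_rotate_iff x hx).2 hy
  have h := congrArg Walk.length ((c.rotate x hx).take_spec hy')
  rw [Walk.length_append, Walk.length_rotate] at h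
  by_cases h1 : ((c.rotate x hx).takeUntil y hy').length ≤ c.length / 2
  · exact ⟨_, h1⟩
  · refine ⟨((c.rotate x hx).dropUntil y hy').reverse, ?_⟩
    rw [Walk.length_reverse]
    omega

theorem exists_walk_edges_mem_of_isGeodesic (hgeo : IsGeodesic c) {x y : V}
    (hx : x ∈ c.support) (hy : y ∈ c.support) (q : G.Walk x y) :
    ∃ w : G.Walk x y, (∀ e ∈ w.edges, e ∈ c.edges) ∧ w.length ≤ q.length := by
  classical
  obtain ⟨w, -, hw, hmin⟩ := hgeo x hx y hy
  exact ⟨w, hw, (hmin _ q.bypass_isPath).trans q.length_bypass_le_length⟩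

/-- Splitting a cycle at two vertices yields two arcs meeting in these vertices only. -/
theorem Walk.IsCycle.eq_or_eq_of_mem_append {a b : V} {w₁ : G.Walk a b} {w₂ : G.Walk b a}
    (h : (w₁.append w₂).IsCycle) {z : V} (h₁ : z ∈ w₁.support) (h₂ : z ∈ w₂.support) :
    z = a ∨ z = b := by
  by_contra! hz
  have h₁' : z ∈ w₁.support.tail := ((Walk.mem_support_iff w₁).1 h₁).resolve_left hz.1
  have h₂' : z ∈ w₂.support.tail := ((Walk.mem_support_iff w₂).1 h₂).resolve_left hz.2
  have hn := h.support_nodup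
  rw [Walk.tail_support_append] at hn
  exact List.disjoint_of_nodup_append hn h₁' h₂'

theorem Walk.IsCycle.mem_support_of_walk_avoiding {a b : V} {w₁ : G.Walk a b} {w₂ : G.Walk b a}
    (h : (w₁.append w₂).IsCycle) {x y : V} (q : G.Walk x y)
    (hq : ∀ e ∈ q.edges, e ∈ (w₁.append w₂).edges) (ha : a ∉ q.support) (hb : b ∉ q.support)
    (hx : x ∈ w₁.support) : y ∈ w₁.support := by
  induction q with
  | nil => exact hx
  | @cons x d y had q ih =>
    simp only [Walk.support_cons, List.mem_cons, not_or] at ha hb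
    refine ih (fun e he => hq e (by simp [Walk.edges_cons, he])) ha.2 hb.2 ?_
    have he := hq s(x, d) (by simp [Walk.edges_cons])
    rw [Walk.edges_append, List.mem_append] at he
    rcases he with he | he
    · exact w₁.snd_mem_support_of_mem_edges he
    · rcases h.eq_or_eq_of_mem_append hx (w₂.fst_mem_support_of_mem_edges he) with rfl | rfl
      · exact absurd rfl ha.1
      · exact absurd rfl hb.1

end Cycle

section Cluster

variable {V : Type*} {G : SimpleGraph V}

/-- The graph on `X` joining any two vertices at distance at most `r` in `G`. -/
def nearGraph (G : SimpleGraph V) (X : Set V) (r : ℕ) : SimpleGraph X :=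
  fromRel fun x y => ∃ q : G.Walk x y, q.length ≤ r

theorem nearGraph_reachable_of_walk {X : Set V} {r : ℕ} {x y : X} (q : G.Walk x y)
    (hq : q.length ≤ r) : (nearGraph G X r).Reachable x y := by
  by_cases h : x = y
  · rw [h]
  · exact Adj.reachable ((fromRel_adj _ _ _).2 ⟨h, Or.inl ⟨q, hq⟩⟩)

theorem exists_walk_length_le_mul_of_nearGraph_walk {X : Set V} {r : ℕ} {x y : X}
    (w : (nearGraph G X r).Walk x y) : ∃ q : G.Walk x y, q.length ≤ r * w.length := by
  induction w with
  | nil => exact ⟨Walk.nil, by simp⟩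
  | cons h w ih =>
    obtain ⟨q, hq⟩ := ih
    obtain ⟨-, ⟨q', hq'⟩ | ⟨q', hq'⟩⟩ := (fromRel_adj _ _ _).1 h
    · exact ⟨q'.append q, by rw [Walk.length_append, Walk.length_cons, mul_add]; omega⟩
    · exact ⟨q'.reverse.append q, by
        rw [Walk.length_append, Walk.length_cons, Walk.length_reverse, mul_add]; omega⟩

theorem exists_walk_length_lt_ncard_supp {V : Type*} [Finite V] {G : SimpleGraph V}
    (K : G.ConnectedComponent) {x y : V} (hx : x ∈ K.supp) (hy : y ∈ K.supp) :
    ∃ w : G.Walk x y, w.length < K.supp.ncard := by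
  classical
  obtain ⟨w, hw⟩ := (K.reachable_of_mem_supp hx hy).exists_isPath
  refine ⟨w, ?_⟩
  have hsub : (w.support.toFinset : Set V) ⊆ K.supp := by
    intro z hz
    simp only [List.coe_toFinset, Set.mem_ofPred_eq] at hz
    have : G.Reachable x z := ⟨w.takeUntil z hz⟩
    rw [ConnectedComponent.mem_supp_iff] at hx ⊢
    rw [← hx]
    exact (ConnectedComponent.eq.2 this).symm
  have := Set.ncard_le_ncard hsub (Set.toFinite _)
  rw [Set.ncard_coe_finset, List.toFinset_card_of_nodup hw.support_nodup,
    Walk.length_support] at this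
  omega

theorem exists_ncard_le_of_cluster [Finite V] {v : V} {c : G.Walk v v} (hc : c.IsCycle)
    (hgeo : IsGeodesic c) {X : Set V} {r : ℕ} (hr : 0 < r)
    (K : (nearGraph G X r).ConnectedComponent) :
    ∃ B : Set V, B.ncard ≤ 2 * r * K.supp.ncard ∧
      ∀ x ∈ K.supp, ∀ y ∈ K.supp, (x : V) ∈ c.support → (y : V) ∈ c.support →
        ∃ q : G.Walk x y, (∀ e ∈ q.edges, e ∈ c.edges) ∧ ∀ z ∈ q.support, z ∈ B := by
  classical
  by_cases hex : ∃ t ∈ K.supp, (t : V) ∈ c.support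
  · obtain ⟨t, htK, htc⟩ := hex
    have hpos : 0 < K.supp.ncard := (Set.ncard_pos (Set.toFinite _)).2 ⟨t, htK⟩
    let R := r * (K.supp.ncard - 1)
    refine ⟨{z | ∃ q : G.Walk t z, (∀ e ∈ q.edges, e ∈ c.edges) ∧ q.length ≤ R},
      (hc.ncard_ball_le htc R).trans ?_, ?_⟩
    · obtain ⟨m, hm⟩ := Nat.exists_eq_succ_of_ne_zero hpos.ne'
      simp only [R, hm, Nat.succ_eq_add_one, Nat.add_sub_cancel]
      nlinarith
    · have key : ∀ x ∈ K.supp, (x : V) ∈ c.support → ∃ q : G.Walk t x,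
          (∀ e ∈ q.edges, e ∈ c.edges) ∧ q.length ≤ R := by
        intro x hx hxc
        obtain ⟨w, hw⟩ := exists_walk_length_lt_ncard_supp K htK hx
        obtain ⟨q, hq⟩ := exists_walk_length_le_mul_of_nearGraph_walk w
        obtain ⟨q', hq', hle⟩ := exists_walk_edges_mem_of_isGeodesic hgeo htc hxc q
        exact ⟨q', hq', hle.trans (hq.trans (Nat.mul_le_mul_left r (by omega)))⟩
      have ball : ∀ {x : V} (q : G.Walk t x), (∀ e ∈ q.edges, e ∈ c.edges) → q.length ≤ R →
          ∀ z ∈ q.support, ∃ q' : G.Walk t z, (∀ e ∈ q'.edges, e ∈ c.edges) ∧ q'.length ≤ R :=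
        fun q hq hqR z hz => ⟨q.takeUntil z hz,
          fun e he => hq e (q.edges_takeUntil_subset_edges hz he),
          (q.length_takeUntil_le_length hz).trans hqR⟩
      intro x hx y hy hxc hyc
      obtain ⟨q₁, h₁, h₁'⟩ := key x hx hxc
      obtain ⟨q₂, h₂, h₂'⟩ := key y hy hyc
      refine ⟨q₁.reverse.append q₂, fun e he => ?_, fun z hz => ?_⟩
      · rw [Walk.edges_append, List.mem_append, Walk.edges_reverse, List.mem_reverse] at he
        exact he.elim (h₁ e) (h₂ e)
      · rw [Walk.mem_support_append_iff, Walk.support_reverse, List.mem_reverse] at hz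
        exact hz.elim (ball q₁ h₁ h₁' z) (ball q₂ h₂ h₂' z)
  · exact ⟨∅, by simp, fun x hx _ _ hxc => absurd ⟨x, hx, hxc⟩ hex⟩

/-- All clusters of `X` can be covered, along a geodesic cycle, by few vertices. -/
theorem exists_ncard_le_of_nearGraph [Finite V] {v : V} {c : G.Walk v v} (hc : c.IsCycle)
    (hgeo : IsGeodesic c) (X : Set V) {r : ℕ} (hr : 0 < r) :
    ∃ B : Set V, B.ncard ≤ 2 * r * X.ncard ∧
      ∀ x y : X, (nearGraph G X r).Reachable x y → (x : V) ∈ c.support → (y : V) ∈ c.support →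
        ∃ q : G.Walk x y, (∀ e ∈ q.edges, e ∈ c.edges) ∧ ∀ z ∈ q.support, z ∈ B := by
  classical
  choose B hB hBq using exists_ncard_le_of_cluster hc hgeo (X := X) hr
  have := Fintype.ofFinite (nearGraph G X r).ConnectedComponent
  have := Fintype.ofFinite X
  refine ⟨⋃ K, B K, ?_, fun x y hxy hxc hyc => ?_⟩
  · have hcard : ∑ K : (nearGraph G X r).ConnectedComponent, K.supp.ncard = X.ncard := by
      have h := Finset.card_eq_sum_card_fiberwise (f := (nearGraph G X r).connectedComponentMk)
        (s := Finset.univ) (t := Finset.univ) (by simp)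
      rw [Finset.card_univ, ← Nat.card_eq_fintype_card, Nat.card_coe_set_eq] at h
      rw [h]
      refine Finset.sum_congr rfl fun K _ => ?_
      rw [← Set.ncard_coe_finset]
      congr 1
      ext x
      simp [ConnectedComponent.mem_supp_iff]
    calc _ ≤ ∑ K, (B K).ncard := Set.ncard_iUnion_le_of_fintype _
      _ ≤ ∑ K : (nearGraph G X r).ConnectedComponent, 2 * r * K.supp.ncard :=
        Finset.sum_le_sum fun K _ => hB K
      _ = _ := by rw [← Finset.mul_sum, hcard]
  · obtain ⟨q, hq, hq'⟩ := hBq ((nearGraph G X r).connectedComponentMk x) x rfl y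
      (ConnectedComponent.eq.2 hxy.symm) hxc hyc
    exact ⟨q, hq, fun z hz => Set.mem_iUnion.2 ⟨_, hq' z hz⟩⟩

end Cluster

end SimpleGraph

theorem component_contains_half_of_cycle
    {V : Type} [Fintype V] (G : SimpleGraph V) (k p : ℕ) (hk : 0 < k) (hp : 0 < p)
    (v : V) (c : G.Walk v v) (hc : c.IsCycle) (hgeo : IsGeodesic c)
    (hlen : 4 * (p / 2) * k ≤ c.length)
    (ι : Type) [Fintype ι] (u : ι → V) (D : ∀ i, G.Walk (u i) (u i))
    (hD : ∀ i, (D i).IsCycle) (hshort : ∀ i, (D i).length ≤ p)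
    (hsum : ∀ e : Sym2 V, e ∈ c.edges ↔ Odd {i : ι | e ∈ (D i).edges}.ncard) :
    ∀ X : Set V, X.ncard ≤ k →
      ∃ K : (G.induce Xᶜ).ConnectedComponent,
        {w : V | w ∈ c.support}.ncard ≤
          2 * ((Subtype.val '' K.supp) ∩ {w : V | w ∈ c.support}).ncard := by
  classical
  intro X hX
  have hr : 0 < p / 2 := by
    obtain ⟨e, he⟩ := List.exists_mem_of_ne_nil _
      (mt (Walk.edges_eq_nil).1 hc.not_nil)
    obtain ⟨i, -⟩ := Set.nonempty_of_ncard_ne_zero ((hsum e).1 he).pos.ne'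
    have := (hD i).three_le_length
    have := hshort i
    omega
  obtain ⟨B, hB, hBq⟩ := exists_ncard_le_of_nearGraph hc hgeo X hr
  have hCcard := hc.ncard_support
  set C : Set V := {w : V | w ∈ c.support}
  have hBC : 2 * B.ncard ≤ C.ncard := by
    have := Nat.mul_le_mul_left (2 * (p / 2)) hX
    rw [hCcard]
    nlinarith
  have hT : C.ncard ≤ 2 * (C \ B).ncard := by
    have := Set.le_ncard_sdiff B C
    omega
  have hCX : ∀ z ∈ C \ B, z ∉ X := by
    rintro z ⟨hzC, hzB⟩ hzX
    obtain ⟨q, -, hq⟩ := hBq ⟨z, hzX⟩ ⟨z, hzX⟩ (Reachable.refl _) hzC hzC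
    exact hzB (hq z q.start_mem_support)
  obtain ⟨a, ha⟩ : (C \ B).Nonempty := by
    refine Set.nonempty_of_ncard_ne_zero ?_
    have := hc.three_le_length
    omega
  refine ⟨(G.induce Xᶜ).connectedComponentMk ⟨a, hCX a ha⟩, hT.trans ?_⟩
  gcongr
  · exact Set.toFinite _
  intro b hb
  refine ⟨?_, hb.1⟩
  set K : Set V := Subtype.val '' ((G.induce Xᶜ).connectedComponentMk ⟨a, hCX a ha⟩).supp
  by_contra hbK
  have haK : a ∈ K := ⟨⟨a, hCX a ha⟩, rfl, rfl⟩
  have hKX : Disjoint K X := by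
    rw [Set.disjoint_left]
    rintro _ ⟨z, -, rfl⟩
    exact z.2
  have hK : ∀ u ∈ K, ∀ x, G.Adj u x → x ∉ X → x ∈ K := by
    rintro _ ⟨z, hz, rfl⟩ x hzx hxX
    refine ⟨⟨x, hxX⟩, ?_, rfl⟩
    rw [ConnectedComponent.mem_supp_iff] at hz ⊢
    rw [← hz]
    exact ConnectedComponent.eq.2 (Adj.reachable (induce_adj.2 hzx.symm))
  have hbc : b ∈ (c.rotate a ha.1).support := (c.mem_support_rotate_iff a ha.1).2 hb.1
  obtain ⟨w₁, w₂, hw⟩ : ∃ (w₁ : G.Walk a b) (w₂ : G.Walk b a), w₁.append w₂ = c.rotate a ha.1 :=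
    ⟨_, _, (c.rotate a ha.1).take_spec hbc⟩
  have hcyc : (w₁.append w₂).IsCycle := hw ▸ (Walk.isCycle_rotate ha.1).2 hc
  have hedges : (w₁.append w₂).edges.Perm c.edges := hw ▸ (c.rotate_edges a ha.1).perm
  have hsupp : ∀ z, z ∈ w₁.support ∨ z ∈ w₂.support → z ∈ c.support := by
    intro z hz
    rwa [← Walk.mem_support_append_iff, hw, Walk.mem_support_rotate_iff] at hz
  let Y : Set V := {x | ∃ hx : x ∈ X, ∃ y : X,
    (nearGraph G X (p / 2)).Reachable y ⟨x, hx⟩ ∧ (y : V) ∈ w₁.support}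
  have hYX : Y ⊆ X := fun x hx => hx.1
  have hw₁ : ∀ x ∈ w₁.support, x ∈ X → x ∈ Y :=
    fun x hx hxX => ⟨hxX, ⟨x, hxX⟩, Reachable.refl _, hx⟩
  have hw₂ : ∀ x ∈ w₂.support, x ∉ Y := by
    rintro x hx ⟨hxX, y, hyx, hy⟩
    obtain ⟨q, hq, hqB⟩ := hBq y ⟨x, hxX⟩ hyx (hsupp _ (Or.inl hy)) (hsupp _ (Or.inr hx))
    have hx₁ : x ∈ w₁.support := hcyc.mem_support_of_walk_avoiding q
      (fun e he => hedges.mem_iff.2 (hq e he)) (fun h => ha.2 (hqB a h))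
      (fun h => hb.2 (hqB b h)) hy
    rcases hcyc.eq_or_eq_of_mem_append hx₁ hx with rfl | rfl
    · exact hCX _ ha hxX
    · exact hCX _ hb hxX
  have hone : (c.edges.map (cutIndicator K Y)).sum = 1 := by
    rw [← (hedges.map _).sum_eq, Walk.edges_append, List.map_append, List.sum_append,
      sum_cutIndicator_edges hYX hKX hK w₁ hw₁, sum_cutIndicator_edges_eq_zero w₂ hw₂,
      if_pos haK, if_neg hbK, add_zero, add_zero]
  have hzero : (c.edges.map (cutIndicator K Y)).sum = 0 := by
    rw [sum_map_edges_eq_of_mod_two_sum hc.isTrail (fun i => (hD i).isTrail) hsum]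
    refine Finset.sum_eq_zero fun i _ => ?_
    by_cases hi : ∃ x ∈ (D i).support, x ∈ Y
    · obtain ⟨x, hx, hxX, y, hyx, hy⟩ := hi
      rw [sum_cutIndicator_edges hYX hKX hK (D i), CharTwo.add_self_eq_zero]
      intro z hz hzX
      obtain ⟨q, hq⟩ := (D i).exists_walk_length_le_half hx hz
      exact ⟨hzX, y, hyx.trans (nearGraph_reachable_of_walk (x := ⟨x, hxX⟩) (y := ⟨z, hzX⟩) q
        (hq.trans (Nat.div_le_div_right (hshort i)))), hy⟩
    · exact sum_cutIndicator_edges_eq_zero _ fun x hx hxY => hi ⟨x, hx, hxY⟩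
  exact one_ne_zero (hone.symm.trans hzero)
end

section
/- Let d be a positive integer, G a graph, X ⊆ V(G) a set of vertices, and C ⊆ G a geodesic cycle. Then there exists a family ℛ of pairwise disjoint vertex-sets of G with X ⊆ ⋃ℛ ⊆ X ∪ V(C) and |⋃ℛ ∩ V(C)| ≤ 2·d·|X|, such that for each R ∈ ℛ the set R ∩ V(C) induces a (possibly empty) connected subgraph of C, and the distance in G between any two distinct sets of ℛ is greater than d. -/
open SimpleGraph

/-- `g` winds the integers around a cycle of length `N` with edge set `E`, in such a way that walks
of `G` between vertices of the cycle do not take shortcuts. -/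
structure IsGeodesicWinding {V : Type*} (G : SimpleGraph V) (E : Set (Sym2 V)) (N : ℕ)
    (g : ℤ → V) : Prop where
  pos : 0 < N
  eq_iff : ∀ i j, g i = g j ↔ (N : ℤ) ∣ i - j
  adj : ∀ i, (fromEdgeSet E).Adj (g i) (g (i + 1))
  geodesic : ∀ (i j : ℤ) (t : ℕ), (∃ p : G.Walk (g i) (g j), p.length ≤ t) →
    ∃ j', g j' = g j ∧ |i - j'| ≤ t

theorem SimpleGraph.Walk.exists_getVert_of_mem_edges {V : Type*} {G : SimpleGraph V} {u v : V}
    (p : G.Walk u v) {e : Sym2 V} (he : e ∈ p.edges) :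
    ∃ n < p.length, e = s(p.getVert n, p.getVert (n + 1)) := by
  induction p with
  | nil => simp at he
  | cons h q ih =>
    rw [Walk.edges_cons, List.mem_cons] at he
    rcases he with rfl | he
    · exact ⟨0, by simp, by simp⟩
    · obtain ⟨n, hn, rfl⟩ := ih he
      exact ⟨n + 1, by simpa using hn, by simp⟩

theorem SimpleGraph.Walk.mk_getVert_mem_edges {V : Type*} {G : SimpleGraph V} {u v : V}
    (p : G.Walk u v) {n : ℕ} (hn : n < p.length) :
    s(p.getVert n, p.getVert (n + 1)) ∈ p.edges := by
  induction p generalizing n with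
  | nil => simp at hn
  | cons h q ih =>
    rw [Walk.edges_cons, List.mem_cons]
    cases n with
    | zero => left; simp
    | succ n => right; simpa using ih (by simpa using hn)

theorem exists_geodesicWinding {V : Type*} {G : SimpleGraph V} {v : V} (c : G.Walk v v)
    (hc : c.IsCycle) (hgeo : IsGeodesic c) :
    ∃ (N : ℕ) (g : ℤ → V), IsGeodesicWinding G {e | e ∈ c.edges} N g ∧
      {w | w ∈ c.support} = Set.range g := by
  set N := c.length with hN
  have h3 : 3 ≤ N := hc.three_le_length
  have hN0 : (0 : ℤ) < N := by omega
  let g : ℤ → V := fun i => c.getVert (i % N).toNat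
  have hmod (i : ℤ) : 0 ≤ i % N ∧ i % N < N :=
    ⟨Int.emod_nonneg _ hN0.ne', Int.emod_lt_of_pos _ hN0⟩
  have heq (i j : ℤ) : g i = g j ↔ (N : ℤ) ∣ i - j := by
    rw [Int.dvd_iff_emod_eq_zero, ← Int.emod_eq_emod_iff_emod_sub_eq_zero]
    refine ⟨fun h => ?_, fun h => by simp only [g, h]⟩
    have hi := hmod i
    have hj := hmod j
    have := hc.getVert_injOn' (by simp only [Set.mem_ofPred_eq]; omega)
      (by simp only [Set.mem_ofPred_eq]; omega) h
    omega
  have hnat (n : ℕ) (hn : n ≤ N) : g n = c.getVert n := by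
    rcases hn.lt_or_eq with h | rfl
    · simp only [g]
      rw [Int.emod_eq_of_lt (by omega) (by omega)]; simp
    · simp [g, hN]
  have hsupp : {w | w ∈ c.support} = Set.range g := by
    ext w
    simp only [Set.mem_ofPred_eq, Set.mem_range, Walk.mem_support_iff_exists_getVert]
    constructor
    · rintro ⟨n, rfl, hn⟩
      exact ⟨n, hnat n hn⟩
    · rintro ⟨i, rfl⟩
      exact ⟨_, rfl, by have := hmod i; omega⟩
  have hedge (i : ℤ) : s(g i, g (i + 1)) ∈ c.edges := by
    have h1 : g i = g (i % N).toNat := by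
      rw [heq, Int.toNat_of_nonneg (hmod i).1]
      exact Int.dvd_self_sub_emod
    have h2 : g (i + 1) = g ((i % N).toNat + 1 : ℕ) := by
      rw [heq]; push_cast
      rw [Int.toNat_of_nonneg (hmod i).1]
      have := Int.dvd_self_sub_emod (x := i) (m := N)
      simpa using this
    have := hmod i
    rw [h1, h2, hnat _ (by omega), hnat _ (by omega)]
    exact c.mk_getVert_mem_edges (by omega)
  have hstep (i : ℤ) (w : V) (hw : s(g i, w) ∈ c.edges) : w = g (i + 1) ∨ w = g (i - 1) := by
    obtain ⟨n, hn, h⟩ := c.exists_getVert_of_mem_edges hw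
    rw [← hnat n (by omega), ← hnat (n + 1) (by omega)] at h
    rcases Sym2.eq_iff.1 h with ⟨h1, rfl⟩ | ⟨h1, rfl⟩ <;> rw [heq] at h1
    · left; rw [heq]; obtain ⟨k, hk⟩ := h1; exact ⟨-k, by push_cast at hk ⊢; linarith⟩
    · right; rw [heq]; obtain ⟨k, hk⟩ := h1; exact ⟨-k, by push_cast at hk ⊢; linarith⟩
  have hwalk : ∀ (u w : V) (p : G.Walk u w), (∀ e ∈ p.edges, e ∈ c.edges) → ∀ i, g i = u →
      ∃ j, g j = w ∧ |i - j| ≤ p.length := by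
    intro u w p
    induction p with
    | nil => intro _ i hi; exact ⟨i, hi, by simp⟩
    | cons h q ih =>
      intro he i hi
      simp only [Walk.edges_cons, List.mem_cons, forall_eq_or_imp] at he
      subst hi
      rcases hstep i _ he.1 with h' | h'
      · obtain ⟨j, hj, hij⟩ := ih he.2 _ h'.symm
        refine ⟨j, hj, ?_⟩
        rw [abs_le] at hij ⊢; simp only [Walk.length_cons]; push_cast; constructor <;> omega
      · obtain ⟨j, hj, hij⟩ := ih he.2 _ h'.symm
        refine ⟨j, hj, ?_⟩
        rw [abs_le] at hij ⊢; simp only [Walk.length_cons]; push_cast; constructor <;> omega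
  refine ⟨N, g, ⟨by omega, heq, fun i => ?_, ?_⟩, hsupp⟩
  · rw [fromEdgeSet_adj]
    exact ⟨hedge i, (c.adj_of_mem_edges (hedge i)).ne⟩
  · classical
    rintro i j t ⟨q, hq⟩
    have hi : g i ∈ c.support := hsupp.ge ⟨i, rfl⟩
    have hj : g j ∈ c.support := hsupp.ge ⟨j, rfl⟩
    obtain ⟨p, -, hp, hmin⟩ := hgeo _ hi _ hj
    obtain ⟨j', hj', hij⟩ := hwalk _ _ p hp i rfl
    refine ⟨j', hj', hij.trans ?_⟩
    have h1 := hmin q.bypass q.bypass_isPath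
    have h2 := q.length_bypass_le_length
    exact_mod_cast (h1.trans h2).trans hq

/-- The perimeter of a triangle in a connected graph is at most twice the number of edges of a
spanning tree. -/
theorem SimpleGraph.dist_add_dist_add_dist_le {V : Type*} [Finite V] {H : SimpleGraph V}
    {x y z : V} (hxy : H.Reachable x y) (hxz : H.Reachable x z) :
    H.dist x y + H.dist y z + H.dist x z + 2 ≤
      2 * (H.connectedComponentMk x).supp.ncard := by
  classical
  obtain ⟨P, hP, hPl⟩ := hxy.exists_path_of_dist
  obtain ⟨w, hw, hmin⟩ := P.support.toFinset.exists_min_image (fun w => H.dist z w) ⟨x, by simp⟩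
  simp only [List.mem_toFinset] at hw hmin
  have hxw : H.Reachable x w := (P.takeUntil w hw).reachable
  have hzw : H.Reachable z w := hxz.symm.trans hxw
  obtain ⟨Q, hQ, hQl⟩ := hzw.exists_path_of_dist
  have hinter : P.support.toFinset ∩ Q.support.toFinset ⊆ {w} := by
    intro a ha
    simp only [Finset.mem_inter, List.mem_toFinset] at ha
    rw [Finset.mem_singleton]
    by_contra hne
    have h1 := hmin a ha.1
    have h2 := Q.length_takeUntil_lt_length ha.2 hne
    have h3 := dist_le (Q.takeUntil a ha.2)
    omega
  have hsub : ((P.support.toFinset ∪ Q.support.toFinset : Finset V) : Set V) ⊆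
      (H.connectedComponentMk x).supp := by
    intro a ha
    simp only [Finset.coe_union, Set.mem_union, Finset.mem_coe, List.mem_toFinset] at ha
    rw [ConnectedComponent.mem_supp_iff, ConnectedComponent.eq]
    rcases ha with ha | ha
    · exact (P.takeUntil a ha).reachable.symm
    · exact (hxz.trans (Q.takeUntil a ha).reachable).symm
  have hcard := Set.ncard_le_ncard hsub
  rw [Set.ncard_coe_finset] at hcard
  have hui := Finset.card_union_add_card_inter P.support.toFinset Q.support.toFinset
  have h1 := Finset.card_le_card hinter
  rw [List.toFinset_card_of_nodup hP.support_nodup, List.toFinset_card_of_nodup hQ.support_nodup,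
    Walk.length_support, Walk.length_support] at hui
  rw [Finset.card_singleton] at h1
  have hsplit := congrArg Walk.length (P.take_spec hw)
  rw [Walk.length_append] at hsplit
  have h2 := dist_le (P.takeUntil w hw)
  have h3 := dist_le (P.dropUntil w hw)
  have h4 : H.dist x z ≤ H.dist x w + H.dist w z := by
    exact hxw.dist_triangle_left z
  have h5 : H.dist y z ≤ H.dist w y + H.dist w z := by
    rw [dist_comm (u := w) (v := y)]
    exact (hxy.symm.trans hxw).dist_triangle_left z
  have h6 : H.dist z w = H.dist w z := dist_comm
  omega

/-- The conclusion of `extend_separator` for the family `R`, where `C` and `E` are the vertex set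
and the edge set of the cycle. -/
structure IsSeparatedExtension {V : Type*} (G : SimpleGraph V) (E : Set (Sym2 V)) (C : Set V)
    (d : ℕ) (X : Set V) (R : Set (Set V)) : Prop where
  disjoint : ∀ A ∈ R, ∀ B ∈ R, A ≠ B → Disjoint A B
  subset_sUnion : X ⊆ ⋃₀ R
  sUnion_subset : ⋃₀ R ⊆ X ∪ C
  ncard_le : ((⋃₀ R) ∩ C).ncard ≤ 2 * d * X.ncard
  connected : ∀ A ∈ R, A ∩ C = ∅ ∨ ((fromEdgeSet E).induce (A ∩ C)).Connected
  separated : ∀ A ∈ R, ∀ B ∈ R, A ≠ B → ∀ x ∈ A, ∀ y ∈ B, ∀ p : G.Walk x y, d < p.length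

theorem isSeparatedExtension_singleton {V : Type*} {G : SimpleGraph V} {E : Set (Sym2 V)}
    {C A X : Set V} {d : ℕ} (hXA : X ⊆ A) (hA : A ⊆ X ∪ C) (hcard : (A ∩ C).ncard ≤ 2 * d * X.ncard)
    (hconn : A ∩ C = ∅ ∨ ((fromEdgeSet E).induce (A ∩ C)).Connected) :
    IsSeparatedExtension G E C d X {A} where
  disjoint := by rintro _ rfl _ rfl h; exact absurd rfl h
  subset_sUnion := by rwa [Set.sUnion_singleton]
  sUnion_subset := by rwa [Set.sUnion_singleton]
  ncard_le := by rwa [Set.sUnion_singleton]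
  connected := by rintro _ rfl; exact hconn
  separated := by rintro _ rfl _ rfl h; exact absurd rfl h

/-- The edges of `H` with both ends in `S`, as a graph on the vertex set of `H`. -/
def SimpleGraph.restrictTo {V : Type*} (H : SimpleGraph V) (S : Set V) : SimpleGraph V where
  Adj u v := H.Adj u v ∧ u ∈ S ∧ v ∈ S
  symm := ⟨fun _ _ h => ⟨h.1.symm, h.2.2, h.2.1⟩⟩
  loopless := ⟨fun _ h => h.1.ne rfl⟩

theorem SimpleGraph.connected_induce_supp_restrictTo {V : Type*} {H : SimpleGraph V} {S : Set V}
    (κ : (H.restrictTo S).ConnectedComponent) : (H.induce κ.supp).Connected := by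
  refine κ.connected_toSimpleGraph.mono fun u v h => ?_
  have h' : (H.restrictTo S).Adj u v := h
  exact h'.1

theorem SimpleGraph.mem_of_reachable_restrictTo {V : Type*} {H : SimpleGraph V} {S : Set V}
    {u v : V} (h : (H.restrictTo S).Reachable u v) (hu : u ∈ S) : v ∈ S := by
  obtain ⟨p⟩ := h
  induction p with
  | nil => exact hu
  | cons h _ ih => exact ih h.2.2

namespace IsGeodesicWinding

variable {V : Type*} {G : SimpleGraph V} {E : Set (Sym2 V)} {N : ℕ} {g : ℤ → V}

theorem apply_add (hg : IsGeodesicWinding G E N g) {m : ℤ} (hm : (N : ℤ) ∣ m) (i : ℤ) :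
    g (i + m) = g i := by
  rw [hg.eq_iff]; simpa using hm

theorem apply_add_congr (hg : IsGeodesicWinding G E N g) {i j : ℤ} (h : g i = g j) (k : ℤ) :
    g (i + k) = g (j + k) := by
  rw [hg.eq_iff] at *; simpa using h

theorem reachable_of_Icc_subset (hg : IsGeodesicWinding G E N g) {W : Set ℤ} {i j : ℤ}
    (hij : i ≤ j) (h : Set.Icc i j ⊆ W) :
    ((fromEdgeSet E).restrictTo (g '' W)).Reachable (g i) (g j) := by
  induction j, hij using Int.leInduction with
  | base => exact Reachable.refl _
  | succ n hn ih =>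
    refine (ih fun t ht => h ⟨ht.1, ht.2.trans (by omega)⟩).trans (Adj.reachable ?_)
    exact ⟨hg.adj n, ⟨n, h ⟨hn, by omega⟩, rfl⟩, ⟨n + 1, h ⟨by omega, le_rfl⟩, rfl⟩⟩

theorem ncard_image_Icc_le (l r : ℤ) (g : ℤ → V) :
    (g '' Set.Icc l r).ncard ≤ (r + 1 - l).toNat := by
  refine (Set.ncard_image_le (Set.finite_Icc l r)).trans ?_
  rw [← Finset.coe_Icc, Set.ncard_coe_finset, Int.card_Icc]

theorem connected_induce_image_Icc (hg : IsGeodesicWinding G E N g) {l r : ℤ} (hlr : l ≤ r) :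
    ((fromEdgeSet E).induce (g '' Set.Icc l r)).Connected := by
  have := connected_induce_supp_restrictTo
    (((fromEdgeSet E).restrictTo (g '' Set.Icc l r)).connectedComponentMk (g l))
  suffices h : (((fromEdgeSet E).restrictTo (g '' Set.Icc l r)).connectedComponentMk (g l)).supp =
      g '' Set.Icc l r by rwa [h] at this
  ext v
  rw [ConnectedComponent.mem_supp_iff, ConnectedComponent.eq]
  constructor
  · intro h
    exact mem_of_reachable_restrictTo h.symm ⟨l, ⟨le_rfl, hlr⟩, rfl⟩
  · rintro ⟨i, hi, rfl⟩
    exact (hg.reachable_of_Icc_subset hi.1 (Set.Icc_subset_Icc_right hi.2)).symm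

theorem exists_extension_of_subset_image_Icc (hg : IsGeodesicWinding G E N g) {d : ℕ} {X : Set V}
    {l r : ℤ} (hlr : l ≤ r) (hX : X ∩ Set.range g ⊆ g '' Set.Icc l r)
    (hcard : r - l + 1 ≤ 2 * d * X.ncard) :
    ∃ R, IsSeparatedExtension G E (Set.range g) d X R := by
  have h : (X ∪ g '' Set.Icc l r) ∩ Set.range g = g '' Set.Icc l r := by
    rw [Set.union_inter_distrib_right, Set.inter_eq_left.2 (Set.image_subset_range _ _)]
    exact Set.union_eq_right.2 hX
  refine ⟨_, isSeparatedExtension_singleton (A := X ∪ g '' Set.Icc l r) Set.subset_union_left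
    (Set.union_subset_union_right _ (Set.image_subset_range _ _)) ?_ (Or.inr ?_)⟩
  · rw [h]
    refine (ncard_image_Icc_le l r g).trans ?_
    zify
    rw [Int.toNat_of_nonneg (by omega)]
    linarith
  · rw [h]
    exact hg.connected_induce_image_Icc hlr

/-- Arcs `[lo x, hi x]` attached to the vertices of `X` yield a separated extension: fill the gaps
of length at most `d` between the arcs, and put each `x` together with the component of its arc. -/
theorem exists_extension_of_arcs [Finite V] (hg : IsGeodesicWinding G E N g) {d : ℕ} (hd : 0 < d)
    {X : Set V} {lo hi : V → ℤ} (hle : ∀ x ∈ X, lo x ≤ hi x)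
    (hmem : ∀ x ∈ X, ∀ j, g j = x → ∃ j', g j' = g j ∧ lo x ≤ j' ∧ j' ≤ hi x)
    (hXC : ∀ x ∈ X, ∀ c, (∃ p : G.Walk x (g c), p.length ≤ d) →
      ∃ c', g c' = g c ∧ lo x - d ≤ c' ∧ c' ≤ hi x + d)
    (hXX : ∀ x ∈ X, ∀ y ∈ X, (∃ p : G.Walk x y, p.length ≤ d) →
      ∃ m, (N : ℤ) ∣ m ∧ lo y + m - hi x ≤ d ∧ lo x - (hi y + m) ≤ d)
    (hcount : (⋃ x ∈ X, g '' Set.Icc (lo x) (hi x + d - 1)).ncard ≤ 2 * d * X.ncard) :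
    ∃ R, IsSeparatedExtension G E (Set.range g) d X R := by
  classical
  let B : Set ℤ := {i | ∃ x ∈ X, ∃ i', g i' = g i ∧ lo x ≤ i' ∧ i' ≤ hi x}
  let W : Set ℤ := {i | ∃ p q : ℤ, 0 ≤ p ∧ 0 ≤ q ∧ p + q ≤ d ∧ i - p ∈ B ∧ i + q ∈ B}
  have hBW : B ⊆ W := fun i hi => 
    ⟨0, 0, le_rfl, le_rfl, by omega, by simpa using hi, by simpa using hi⟩
  have hBeq : ∀ {i j}, g i = g j → i ∈ B → j ∈ B := by
    rintro i j h ⟨x, hx, i', hi', h'⟩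
    exact ⟨x, hx, i', hi'.trans h, h'⟩
  have hWeq : ∀ {i j}, g i = g j → i ∈ W → j ∈ W := by
    rintro i j h ⟨p, q, hp, hq, hpq, h1, h2⟩
    refine ⟨p, q, hp, hq, hpq, hBeq ?_ h1, hBeq (hg.apply_add_congr h q) h2⟩
    simpa [sub_eq_add_neg] using hg.apply_add_congr h (-p)
  let K := (fromEdgeSet E).restrictTo (g '' W)
  have hJB : ∀ x ∈ X, ∀ i, lo x ≤ i → i ≤ hi x → i ∈ B :=
    fun x hx i h1 h2 => ⟨x, hx, i, rfl, h1, h2⟩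
  -- the component of an arc
  have hJ : ∀ x ∈ X, ∀ i, lo x ≤ i → i ≤ hi x →
      K.connectedComponentMk (g (lo x)) = K.connectedComponentMk (g i) := by
    intro x hx i h1 h2
    rw [ConnectedComponent.eq]
    exact hg.reachable_of_Icc_subset h1 fun t ht => hBW (hJB x hx t ht.1 (ht.2.trans h2))
  have hnear' : ∀ i ∈ W, ∀ j ∈ W, i ≤ j → j ≤ i + d →
      K.connectedComponentMk (g i) = K.connectedComponentMk (g j) := by
    rintro i ⟨p, q, hp, hq, hpq, h1, h2⟩ j ⟨p', q', hp', hq', hpq', h1', h2'⟩ hij hjd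
    rw [ConnectedComponent.eq]
    refine hg.reachable_of_Icc_subset hij fun t ht => ?_
    obtain ⟨ht1, ht2⟩ := ht
    by_cases hc1 : t ≤ i + q
    · exact ⟨t - (i - p), i + q - t, by omega, by omega, by omega, by simpa using h1,
        by simpa using h2⟩
    by_cases hc2 : j - p' ≤ t
    · exact ⟨t - (j - p'), j + q' - t, by omega, by omega, by omega, by simpa using h1',
        by simpa using h2'⟩
    · exact ⟨t - (i + q), j - p' - t, by omega, by omega, by omega, by simpa using h2,
        by simpa using h1'⟩
  have hnear : ∀ i ∈ W, ∀ j ∈ W, |i - j| ≤ d →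
      K.connectedComponentMk (g i) = K.connectedComponentMk (g j) := by
    intro i hi j hj h
    rw [abs_le] at h
    rcases le_total i j with hij | hij
    · exact hnear' i hi j hj hij (by omega)
    · exact (hnear' j hj i hi hij (by omega)).symm
  let label : V → K.ConnectedComponent := fun v =>
    K.connectedComponentMk (if v ∈ X then g (lo v) else v)
  have hlabX : ∀ x ∈ X, label x = K.connectedComponentMk (g (lo x)) := fun x hx => by
    simp only [label, if_pos hx]
  have hXW : ∀ x ∈ X, ∀ j, g j = x → j ∈ W := by
    intro x hx j hj
    obtain ⟨j', h, h1, h2⟩ := hmem x hx j hj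
    exact hBW (hBeq h (hJB x hx j' h1 h2))
  have hlabW : ∀ i, label (g i) = K.connectedComponentMk (g i) := by
    intro i
    by_cases h : g i ∈ X
    · obtain ⟨j', hj, h1, h2⟩ := hmem _ h i rfl
      rw [hlabX _ h, hJ _ h j' h1 h2, hj]
    · simp only [label, if_neg h]
  have hsepXW : ∀ x ∈ X, ∀ c ∈ W, (∃ p : G.Walk x (g c), p.length ≤ d) →
      label x = label (g c) := by
    intro x hx c hc hp
    obtain ⟨c', hc', h1, h2⟩ := hXC x hx c hp
    have h0 := hle x hx
    have h3 : lo x ≤ max (lo x) (min c' (hi x)) ∧ max (lo x) (min c' (hi x)) ≤ hi x := by omega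
    rw [hlabX x hx, hlabW, ← hc', hJ x hx _ h3.1 h3.2]
    exact hnear _ (hBW (hJB x hx _ h3.1 h3.2)) _ (hWeq hc'.symm hc) (by rw [abs_le]; omega)
  have hsep : ∀ u ∈ X ∪ g '' W, ∀ v ∈ X ∪ g '' W, (∃ p : G.Walk u v, p.length ≤ d) →
      label u = label v := by
    rintro u (hu | ⟨i, hi, rfl⟩) v (hv | ⟨j, hj, rfl⟩) hp
    · obtain ⟨m, hm, h1, h2⟩ := hXX u hu v hv hp
      have h3 := hle u hu
      have h4 := hle v hv
      obtain ⟨i, j, hi1, hi2, hj1, hj2, hij⟩ : ∃ i j, lo u ≤ i ∧ i ≤ hi u ∧ lo v ≤ j ∧ j ≤ hi v ∧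
          |i - (j + m)| ≤ d := by
        by_cases h5 : hi u ≤ lo v + m
        · exact ⟨hi u, lo v, by omega, by omega, by omega, by omega, by rw [abs_le]; omega⟩
        by_cases h6 : hi v + m ≤ lo u
        · exact ⟨lo u, hi v, by omega, by omega, by omega, by omega, by rw [abs_le]; omega⟩
        · exact ⟨max (lo u) (lo v + m), max (lo u) (lo v + m) - m, by omega, by omega, by omega,
            by omega, by rw [abs_le]; omega⟩
      rw [hlabX u hu, hlabX v hv, hJ u hu i hi1 hi2, hJ v hv j hj1 hj2, ← hg.apply_add hm j]
      exact hnear _ (hBW (hJB u hu i hi1 hi2)) _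
        (hWeq (hg.apply_add hm j).symm (hBW (hJB v hv j hj1 hj2))) hij
    · exact hsepXW u hu j hj hp
    · obtain ⟨p, hp⟩ := hp
      exact (hsepXW v hv i hi ⟨p.reverse, by simpa using hp⟩).symm
    · obtain ⟨j', hj', h⟩ := hg.geodesic i j d hp
      rw [hlabW, hlabW, ← hj']
      exact hnear i hi j' (hWeq hj'.symm hj) h
  let F : K.ConnectedComponent → Set V := fun κ => {v | v ∈ X ∪ g '' W ∧ label v = κ}
  have hUnion : ⋃₀ Set.range F = X ∪ g '' W := by
    ext v
    simp only [Set.mem_sUnion, Set.mem_range, exists_exists_eq_and]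
    exact ⟨fun ⟨_, h, _⟩ => h, fun h => ⟨label v, h, rfl⟩⟩
  have hUC : (X ∪ g '' W) ∩ Set.range g = g '' W := by
    rw [Set.union_inter_distrib_right, Set.inter_eq_left.2 (Set.image_subset_range _ _)]
    refine Set.union_eq_right.2 ?_
    rintro _ ⟨hx, j, rfl⟩
    exact ⟨j, hXW _ hx j rfl, rfl⟩
  refine ⟨Set.range F, ?_, ?_, ?_, ?_, ?_, ?_⟩
  · rintro _ ⟨κ, rfl⟩ _ ⟨κ', rfl⟩ hne
    rw [Set.disjoint_left]
    rintro v ⟨-, rfl⟩ ⟨-, rfl⟩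
    exact hne rfl
  · rw [hUnion]; exact Set.subset_union_left
  · rw [hUnion]; exact Set.union_subset_union_right _ (Set.image_subset_range _ _)
  · rw [hUnion, hUC]
    refine (Set.ncard_le_ncard ?_ (Set.toFinite _)).trans hcount
    rintro _ ⟨i, ⟨p, q, hp, hq, hpq, h1, h2⟩, rfl⟩
    simp only [Set.mem_iUnion]
    by_cases hpd : p = d
    · obtain rfl : q = 0 := by omega
      rw [add_zero] at h2
      obtain ⟨x, hx, i', hi', h3, h4⟩ := h2
      exact ⟨x, hx, i', ⟨h3, by omega⟩, hi'⟩
    · obtain ⟨x, hx, i', hi', h3, h4⟩ := h1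
      refine ⟨x, hx, i' + p, ⟨by omega, by omega⟩, ?_⟩
      simpa using hg.apply_add_congr hi' p
  · rintro _ ⟨κ, rfl⟩
    rcases Set.eq_empty_or_nonempty (F κ ∩ Set.range g) with h | ⟨_, ⟨hv, hvκ⟩, i, rfl⟩
    · exact Or.inl h
    · right
      have hiW : g i ∈ g '' W := hUC.le ⟨hv, i, rfl⟩
      have hF : F κ ∩ Set.range g = κ.supp := by
        ext w
        rw [ConnectedComponent.mem_supp_iff]
        constructor
        · rintro ⟨⟨-, h⟩, j, rfl⟩
          rw [← hlabW, h]
        · intro h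
          have hw : w ∈ g '' W := by
            rw [← hvκ, hlabW, ConnectedComponent.eq] at h
            exact mem_of_reachable_restrictTo h.symm hiW
          obtain ⟨j, hj, rfl⟩ := hw
          exact ⟨⟨Or.inr ⟨j, hj, rfl⟩, (hlabW j).trans h⟩, j, rfl⟩
      rw [hF]
      exact connected_induce_supp_restrictTo κ
  · rintro _ ⟨κ, rfl⟩ _ ⟨κ', rfl⟩ hne x ⟨hx, hxκ⟩ y ⟨hy, hyκ⟩ p
    by_contra hlt
    apply hne
    rw [← hxκ, ← hyκ, hsep x hx y hy ⟨p, not_lt.1 hlt⟩]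

/-- A set of vertices of the cycle lies in a short arc as soon as all its triangles have perimeter
less than the length of the cycle. -/
theorem exists_arc_of_perimeter_lt (hg : IsGeodesicWinding G E N g) {S : Set V} {δ : V → V → ℕ}
    {D : ℕ} (hδ : ∀ i j, g i ∈ S → g j ∈ S → ∃ j', g j' = g j ∧ |i - j'| ≤ δ (g i) (g j))
    (hper : ∀ u ∈ S, ∀ v ∈ S, ∀ w ∈ S, δ u v + δ v w + δ u w < N)
    (hD : ∀ u ∈ S, ∀ v ∈ S, δ u v ≤ D) (hDN : 2 * D < N) :
    ∃ l r : ℤ, l ≤ r ∧ r ≤ l + D ∧ ∀ c, g c ∈ S → ∃ c', g c' = g c ∧ l ≤ c' ∧ c' ≤ r := by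
  classical
  by_cases hne : ∃ c, g c ∈ S
  swap
  · exact ⟨0, 0, le_rfl, by omega, fun c hc => (hne ⟨c, hc⟩).elim⟩
  have huniq : ∀ {i j : ℤ}, g i = g j → |i - j| < N → i = j := by
    intro i j h hlt
    have := Int.eq_zero_of_abs_lt_dvd ((hg.eq_iff i j).1 h) hlt
    omega
  obtain ⟨c₀, hc₀⟩ := hne
  let P : ℕ → Prop := fun t => ∃ l, g l ∈ S ∧ g (l + t) ∈ S
  have hP0 : P 0 := ⟨c₀, hc₀, by simpa using hc₀⟩
  obtain ⟨l, hl, hr⟩ : P (Nat.findGreatest P D) := Nat.findGreatest_spec (Nat.zero_le D) hP0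
  have htD : Nat.findGreatest P D ≤ D := Nat.findGreatest_le D
  have hmax : ∀ i j : ℤ, g i ∈ S → g j ∈ S → j ≤ i + D → j - i ≤ Nat.findGreatest P D := by
    intro i j hi hj hij
    by_contra! hlt
    refine Nat.findGreatest_is_greatest (P := P) (n := D) (k := (j - i).toNat) (by omega) (by omega)
      ⟨i, hi, ?_⟩
    rwa [Int.toNat_of_nonneg (by omega), add_sub_cancel]
  set t := Nat.findGreatest P D
  refine ⟨l, l + t, by omega, by omega, fun c hc => ?_⟩
  obtain ⟨c₁, hc₁, h₁⟩ := hδ l c hl hc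
  obtain ⟨c₂, hc₂, h₂⟩ := hδ (l + t) c hr hc
  obtain ⟨r', hr', h₃⟩ := hδ l (l + t) hl hr
  have hsum := hper _ hl _ hr _ hc
  have hD₁ := hD _ hl _ hc
  have hD₂ := hD _ hr _ hc
  have hD₃ := hD _ hl _ hr
  rw [abs_le] at h₁ h₂ h₃
  obtain rfl : r' = l + t := huniq hr' (by rw [abs_lt]; omega)
  obtain rfl : c₁ = c₂ := huniq (hc₁.trans hc₂.symm) (by rw [abs_lt]; omega)
  have h4 := hmax l c₁ hl (hc₁ ▸ hc) (by omega)
  have h5 := hmax c₁ (l + t) (hc₁ ▸ hc) hr (by omega)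
  exact ⟨c₁, hc₁, by omega, by omega⟩

/-- If `H` joins vertices of `G` at distance at most `d`, then a component of `H` that is small
compared to the cycle has a short arc that comes close to every vertex of the cycle near the
component. -/
theorem exists_arc_near_component [Finite V] (hg : IsGeodesicWinding G E N g) {d : ℕ}
    {H : SimpleGraph V} (hH : ∀ x y, H.Adj x y → ∃ p : G.Walk x y, p.length ≤ d) (x₀ : V)
    (hN : (2 * (H.connectedComponentMk x₀).supp.ncard + 7) * d < N) :
    ∃ lo hi : ℤ, lo ≤ hi ∧ hi - lo ≤ (H.connectedComponentMk x₀).supp.ncard * d ∧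
      ∀ y, H.Reachable x₀ y → ∀ c, (∃ p : G.Walk y (g c), p.length ≤ d + d / 2) →
        ∃ c', g c' = g c ∧ lo - d ≤ c' ∧ c' ≤ hi + d := by
  classical
  set k := (H.connectedComponentMk x₀).supp.ncard with hk
  have hwalk : ∀ x y, H.Reachable x y → ∃ p : G.Walk x y, p.length ≤ d * H.dist x y := by
    intro x y hxy
    obtain ⟨q, hq⟩ := hxy.exists_walk_length_eq_dist
    rw [← hq]
    clear hq
    induction q with
    | nil => exact ⟨Walk.nil, by simp⟩
    | cons h q ih =>
      obtain ⟨p, hp⟩ := hH _ _ h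
      obtain ⟨p', hp'⟩ := ih q.reachable
      refine ⟨p.append p', ?_⟩
      rw [Walk.length_append, Walk.length_cons]
      linarith
  let S : Set V := {v | ∃ y, H.Reachable x₀ y ∧ ∃ p : G.Walk y v, p.length ≤ d + d / 2}
  have hS : ∀ v, ∃ y, v ∈ S → H.Reachable x₀ y ∧ ∃ p : G.Walk y v, p.length ≤ d + d / 2 := by
    intro v
    by_cases hv : v ∈ S
    · obtain ⟨y, hy⟩ := hv
      exact ⟨y, fun _ => hy⟩
    · exact ⟨v, fun h => (hv h).elim⟩
  choose y hy using hS
  have hper : ∀ u ∈ S, ∀ v ∈ S, ∀ w ∈ S,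
      H.dist (y u) (y v) + H.dist (y v) (y w) + H.dist (y u) (y w) + 2 ≤ 2 * k := by
    intro u hu v hv w hw
    have hu' := (hy u hu).1
    have := dist_add_dist_add_dist_le (hu'.symm.trans (hy v hv).1) (hu'.symm.trans (hy w hw).1)
    rwa [← ConnectedComponent.eq.2 hu'] at this
  let δ : V → V → ℕ := fun u v => d * H.dist (y u) (y v) + 2 * (d + d / 2)
  have hδ : ∀ i j, g i ∈ S → g j ∈ S → ∃ j', g j' = g j ∧ |i - j'| ≤ δ (g i) (g j) := by
    intro i j hi hj
    obtain ⟨hi1, p, hp⟩ := hy _ hi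
    obtain ⟨hj1, q, hq⟩ := hy _ hj
    obtain ⟨s, hs⟩ := hwalk _ _ (hi1.symm.trans hj1)
    refine hg.geodesic i j _ ⟨p.reverse.append (s.append q), ?_⟩
    rw [Walk.length_append, Walk.length_append, Walk.length_reverse]
    dsimp only [δ]
    omega
  have hδN : ∀ u ∈ S, ∀ v ∈ S, ∀ w ∈ S, δ u v + δ v w + δ u w < N := by
    intro u hu v hv w hw
    have h1 := Nat.mul_le_mul_left d (hper u hu v hv w hw)
    have h2 : 6 * (d / 2) ≤ 3 * d := by omega
    dsimp only [δ]
    nlinarith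
  have hδD : ∀ u ∈ S, ∀ v ∈ S, δ u v ≤ (k + 2) * d := by
    intro u hu v hv
    have h1 := Nat.mul_le_mul_left d (hper u hu v hv v hv)
    rw [dist_self] at h1
    have h2 : 2 * (d / 2) ≤ d := by omega
    dsimp only [δ]
    have h3 := H.dist_comm (u := y v) (v := y u)
    nlinarith
  obtain ⟨l, r, hlr, hrl, hc⟩ := hg.exists_arc_of_perimeter_lt hδ hδN hδD (by nlinarith)
  push_cast at hrl
  refine ⟨min (l + d) ((l + r) / 2), max (r - d) ((l + r) / 2), by omega, ?_, ?_⟩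
  · have : (d : ℤ) ≤ k * d := by
      have : 1 ≤ k := (Set.ncard_pos (Set.toFinite _)).2 ⟨x₀, rfl⟩
      exact_mod_cast Nat.le_mul_of_pos_left d this
    rw [add_mul] at hrl
    omega
  · intro z hz c hp
    obtain ⟨c', hc', h1, h2⟩ := hc c ⟨z, hz, hp⟩
    exact ⟨c', hc', by omega, by omega⟩

theorem exists_extension_of_inter_eq_empty {d : ℕ} {X : Set V} (h : X ∩ Set.range g = ∅) :
    ∃ R, IsSeparatedExtension G E (Set.range g) d X R :=
  ⟨_, isSeparatedExtension_singleton subset_rfl Set.subset_union_left (by simp [h]) (Or.inl h)⟩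

theorem exists_index_ge (hg : IsGeodesicWinding G E N g) (a i : ℤ) :
    ∃ j, g j = g i ∧ a ≤ j ∧ j < a + N := by
  have hN : (0 : ℤ) < N := by exact_mod_cast hg.pos
  refine ⟨a + (i - a) % N, ?_, ?_, ?_⟩
  · rw [hg.eq_iff]
    obtain ⟨k, hk⟩ := Int.dvd_self_sub_emod (x := i - a) (m := N)
    exact ⟨-k, by linarith⟩
  · linarith [Int.emod_nonneg (i - a) hN.ne']
  · linarith [Int.emod_lt_of_pos (i - a) hN]

theorem exists_arc_pair (hg : IsGeodesicWinding G E N g) (a b : ℤ) :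
    ∃ l r : ℤ, l ≤ r ∧ 2 * (r - l) ≤ N ∧ {g a, g b} ⊆ g '' Set.Icc l r := by
  obtain ⟨b', hb, h1, h2⟩ := hg.exists_index_ge a b
  have haN := hg.apply_add (dvd_refl (N : ℤ)) a
  rw [← hb]
  by_cases h : 2 * (b' - a) ≤ N
  · refine ⟨a, b', h1, h, ?_⟩
    rintro _ (rfl | rfl)
    exacts [⟨a, ⟨le_rfl, h1⟩, rfl⟩, ⟨b', ⟨h1, le_rfl⟩, rfl⟩]
  · refine ⟨b', a + N, h2.le, by omega, ?_⟩
    rintro _ (rfl | rfl)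
    exacts [⟨a + N, ⟨h2.le, le_rfl⟩, haN⟩, ⟨b', ⟨le_rfl, h2.le⟩, rfl⟩]

theorem exists_arc_triple (hg : IsGeodesicWinding G E N g) (a b c : ℤ) :
    ∃ l r : ℤ, l ≤ r ∧ 3 * (r - l) ≤ 2 * N ∧ {g a, g b, g c} ⊆ g '' Set.Icc l r := by
  obtain ⟨b', hb, hb1, hb2⟩ := hg.exists_index_ge a b
  obtain ⟨c', hc, hc1, hc2⟩ := hg.exists_index_ge a c
  rw [← hb, ← hc]
  clear hb hc
  wlog hbc : b' ≤ c' generalizing b' c'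
  · obtain ⟨l, r, h⟩ := this c' hc1 hc2 b' hb1 hb2 (by omega)
    refine ⟨l, r, h.1, h.2.1, ?_⟩
    rw [Set.pair_comm]
    exact h.2.2
  have haN := hg.apply_add (dvd_refl (N : ℤ)) a
  have hbN := hg.apply_add (dvd_refl (N : ℤ)) b'
  by_cases h : 3 * (c' - a) ≤ 2 * N
  · refine ⟨a, c', hc1, h, ?_⟩
    rintro _ (rfl | rfl | rfl)
    exacts [⟨a, ⟨le_rfl, hc1⟩, rfl⟩, ⟨b', ⟨hb1, hbc⟩, rfl⟩, ⟨c', ⟨hc1, le_rfl⟩, rfl⟩]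
  by_cases h' : 3 * (a + N - b') ≤ 2 * N
  · refine ⟨b', a + N, hb2.le, h', ?_⟩
    rintro _ (rfl | rfl | rfl)
    exacts [⟨a + N, ⟨hb2.le, le_rfl⟩, haN⟩, ⟨b', ⟨le_rfl, hb2.le⟩, rfl⟩, ⟨c', ⟨hbc, hc2.le⟩, rfl⟩]
  · refine ⟨c', b' + N, by omega, by omega, ?_⟩
    rintro _ (rfl | rfl | rfl)
    exacts [⟨a + N, ⟨hc2.le, by omega⟩, haN⟩, ⟨b' + N, ⟨by omega, le_rfl⟩, hbN⟩,
      ⟨c', ⟨le_rfl, by omega⟩, rfl⟩]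

/-- If `X` has few vertices on the cycle, then a single set suffices. -/
theorem exists_extension_of_few [Finite V] (hg : IsGeodesicWinding G E N g) {d : ℕ} (hd : 0 < d)
    {X : Set V} {k : ℕ} (hk : 0 < k) (hkX : k + (X ∩ Set.range g).ncard ≤ X.ncard)
    (hXN : 2 * d * X.ncard < N) (hN : N ≤ (2 * k + 7) * d) :
    ∃ R, IsSeparatedExtension G E (Set.range g) d X R := by
  set T := X ∩ Set.range g with hT
  have hdk : d ≤ k * d := Nat.le_mul_of_pos_left d hk
  have hmono := Nat.mul_le_mul_left (2 * d) hkX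
  have hlt : T.ncard < 4 := by
    by_contra! h
    nlinarith
  zify at hdk hmono hXN hN
  interval_cases hcard : T.ncard
  · exact exists_extension_of_inter_eq_empty ((Set.ncard_eq_zero (Set.toFinite _)).1 hcard)
  · obtain ⟨u, hu⟩ := Set.ncard_eq_one.1 hcard
    obtain ⟨a, ha⟩ : u ∈ Set.range g := (hT.le (hu.ge rfl)).2
    refine hg.exists_extension_of_subset_image_Icc (l := a) (r := a) le_rfl ?_ ?_
    · rw [← hT, hu, ← ha]; simp
    · nlinarith
  · obtain ⟨u, v, -, hu⟩ := Set.ncard_eq_two.1 hcard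
    obtain ⟨a, rfl⟩ : u ∈ Set.range g := (hT.le (hu.ge (by simp))).2
    obtain ⟨b, rfl⟩ : v ∈ Set.range g := (hT.le (hu.ge (by simp))).2
    obtain ⟨l, r, hlr, hr, hsub⟩ := hg.exists_arc_pair a b
    refine hg.exists_extension_of_subset_image_Icc hlr (hu.trans_subset hsub) ?_
    nlinarith
  · obtain ⟨u, v, w, -, -, -, hu⟩ := Set.ncard_eq_three.1 hcard
    obtain ⟨a, rfl⟩ : u ∈ Set.range g := (hT.le (hu.ge (by simp))).2
    obtain ⟨b, rfl⟩ : v ∈ Set.range g := (hT.le (hu.ge (by simp))).2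
    obtain ⟨c, rfl⟩ : w ∈ Set.range g := (hT.le (hu.ge (by simp))).2
    obtain ⟨l, r, hlr, hr, hsub⟩ := hg.exists_arc_triple a b c
    refine hg.exists_extension_of_subset_image_Icc hlr (hu.trans_subset hsub) ?_
    nlinarith

theorem ncard_biUnion_arcs_le [Finite V] {d : ℕ} {X : Set V} {H : SimpleGraph V}
    (hHX : ∀ x ∈ X, (H.connectedComponentMk x).supp ⊆ X) {lo hi : H.ConnectedComponent → ℤ}
    (hle : ∀ κ, lo κ ≤ hi κ) (hlen : ∀ κ, hi κ - lo κ ≤ κ.supp.ncard * d) :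
    (⋃ x ∈ X, g '' Set.Icc (lo (H.connectedComponentMk x))
      (hi (H.connectedComponentMk x) + d - 1)).ncard ≤ 2 * d * X.ncard := by
  classical
  have := Fintype.ofFinite V
  let T : H.ConnectedComponent → Finset V := fun κ => (g '' Set.Icc (lo κ) (hi κ + d - 1)).toFinset
  have hU : (⋃ x ∈ X, g '' Set.Icc (lo (H.connectedComponentMk x))
      (hi (H.connectedComponentMk x) + d - 1)) =
      ((X.toFinset.image H.connectedComponentMk).biUnion T : Finset V) := by
    ext v
    simp [T]
  rw [hU, Set.ncard_coe_finset, Set.ncard_eq_toFinset_card' X,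
    Finset.card_eq_sum_card_image H.connectedComponentMk X.toFinset, Finset.mul_sum]
  refine Finset.card_biUnion_le.trans (Finset.sum_le_sum fun κ hκ => ?_)
  obtain ⟨x, hx, rfl⟩ := Finset.mem_image.1 hκ
  rw [Set.mem_toFinset] at hx
  have hfib : {a ∈ X.toFinset | H.connectedComponentMk a = H.connectedComponentMk x}.card =
      (H.connectedComponentMk x).supp.ncard := by
    rw [← Set.ncard_coe_finset]
    congr 1
    ext a
    simp only [Finset.coe_filter, Set.mem_toFinset, Set.mem_ofPred_eq,
      ConnectedComponent.mem_supp_iff, and_iff_right_iff_imp]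
    exact fun h => hHX x hx h
  rw [hfib]
  have h1 : (T (H.connectedComponentMk x)).card ≤ _ :=
    (Set.ncard_eq_toFinset_card' _).symm.trans_le (ncard_image_Icc_le _ _ g)
  refine h1.trans ?_
  have hpos : 1 ≤ (H.connectedComponentMk x).supp.ncard :=
    (Set.ncard_pos (Set.toFinite _)).2 ⟨x, rfl⟩
  have h2 := hle (H.connectedComponentMk x)
  have h3 := hlen (H.connectedComponentMk x)
  have h4 := Nat.le_mul_of_pos_left d hpos
  zify at h4 ⊢
  rw [Int.toNat_of_nonneg (by omega)]
  linarith

theorem exists_extension [Finite V] (hg : IsGeodesicWinding G E N g) {d : ℕ} (hd : 0 < d)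
    (X : Set V) : ∃ R, IsSeparatedExtension G E (Set.range g) d X R := by
  classical
  by_cases hXC : X ∩ Set.range g = ∅
  · exact exists_extension_of_inter_eq_empty hXC
  by_cases hXN : N ≤ 2 * d * X.ncard
  · have hN := hg.pos
    refine hg.exists_extension_of_subset_image_Icc (l := 0) (r := N - 1) (by omega) ?_ ?_
    · rintro _ ⟨-, i, rfl⟩
      obtain ⟨j, hj, h1, h2⟩ := hg.exists_index_ge 0 i
      exact ⟨j, ⟨h1, by omega⟩, hj⟩
    · zify at hXN; linarith
  push Not at hXN
  let far : V → Prop := fun x => ¬ ∃ i, ∃ p : G.Walk x (g i), p.length ≤ d / 2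
  -- far vertices of `X` are grouped into clusters
  let H : SimpleGraph V :=
    { Adj := fun x y => x ≠ y ∧ (x ∈ X ∧ far x) ∧ (y ∈ X ∧ far y) ∧ ∃ p : G.Walk x y, p.length ≤ d
      symm := ⟨fun _ _ ⟨h1, h2, h3, p, hp⟩ => ⟨h1.symm, h3, h2, p.reverse, by simpa using hp⟩⟩
      loopless := ⟨fun _ h => h.1 rfl⟩ }
  have hHfar : ∀ {x y}, H.Reachable x y → x = y ∨ ((x ∈ X ∧ far x) ∧ y ∈ X ∧ far y) := by
    rintro x y ⟨p⟩
    induction p with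
    | nil => exact Or.inl rfl
    | cons h _ ih =>
      rcases ih with rfl | ih
      · exact Or.inr ⟨h.2.1, h.2.2.1⟩
      · exact Or.inr ⟨h.2.1, ih.2⟩
  have hHX : ∀ x ∈ X, (H.connectedComponentMk x).supp ⊆ X := by
    intro x hx y hy
    rcases hHfar (ConnectedComponent.eq.1 hy) with rfl | h
    exacts [hx, h.1.1]
  by_cases hbad : ∃ x ∈ X, far x ∧ (N : ℕ) ≤ (2 * (H.connectedComponentMk x).supp.ncard + 7) * d
  · obtain ⟨x, hx, hfar, hN⟩ := hbad
    have hpos : 0 < (H.connectedComponentMk x).supp.ncard :=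
      (Set.ncard_pos (Set.toFinite _)).2 ⟨x, rfl⟩
    refine hg.exists_extension_of_few hd hpos ?_ hXN hN
    rw [← Set.ncard_union_eq]
    · exact Set.ncard_le_ncard (Set.union_subset (hHX x hx) Set.inter_subset_left)
    · rw [Set.disjoint_left]
      rintro _ hy ⟨-, i, rfl⟩
      have hfar' : far (g i) := by
        rcases hHfar (ConnectedComponent.eq.1 hy) with h | h
        exacts [h ▸ hfar, h.1.2]
      exact hfar' ⟨i, Walk.nil, by simp⟩
  push Not at hbad
  have harc : ∀ κ : H.ConnectedComponent, ∃ lo hi : ℤ, lo ≤ hi ∧ hi - lo ≤ κ.supp.ncard * d ∧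
      ∀ x ∈ X, H.connectedComponentMk x = κ →
        (far x → ∀ c, (∃ p : G.Walk x (g c), p.length ≤ d + d / 2) →
          ∃ c', g c' = g c ∧ lo - d ≤ c' ∧ c' ≤ hi + d) ∧
        (¬ far x → ∃ i, (∃ p : G.Walk x (g i), p.length ≤ d / 2) ∧
          lo = i - (d / 2 : ℕ) ∧ hi = i + (d / 2 : ℕ)) := by
    intro κ
    by_cases hκ : ∃ x ∈ X, far x ∧ H.connectedComponentMk x = κ
    · obtain ⟨x, hx, hfar, rfl⟩ := hκ
      obtain ⟨lo, hi, h1, h2, h3⟩ :=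
        hg.exists_arc_near_component (H := H) (fun a b (h : H.Adj a b) => h.2.2.2) x
          (hbad x hx hfar)
      refine ⟨lo, hi, h1, h2, fun y hy hyx => ⟨fun _ => h3 y (ConnectedComponent.eq.1 hyx.symm),
        fun hny => ?_⟩⟩
      rcases hHfar (ConnectedComponent.eq.1 hyx) with rfl | h
      exacts [(hny hfar).elim, (hny h.1.2).elim]
    · push Not at hκ
      obtain ⟨x, hx⟩ := κ.nonempty_supp
      obtain rfl : H.connectedComponentMk x = κ := hx
      have hpos : 1 ≤ (H.connectedComponentMk x).supp.ncard :=
        (Set.ncard_pos (Set.toFinite _)).2 ⟨x, rfl⟩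
      have h4 := Nat.le_mul_of_pos_left d hpos
      zify at h4
      obtain ⟨i, hi⟩ : ∃ i, x ∈ X → ¬ far x → ∃ p : G.Walk x (g i), p.length ≤ d / 2 := by
        by_cases hfar : far x
        · exact ⟨0, fun _ h => (h hfar).elim⟩
        · obtain ⟨i, hi⟩ := not_not.1 hfar
          exact ⟨i, fun _ _ => hi⟩
      refine ⟨i - (d / 2 : ℕ), i + (d / 2 : ℕ), by omega, by push_cast; omega, fun y hy hyx =>
        ⟨fun hfar => (hκ y hy hfar hyx).elim, fun hny => ?_⟩⟩
      rcases hHfar (ConnectedComponent.eq.1 hyx) with rfl | h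
      exacts [⟨i, hi hy hny, rfl, rfl⟩, (hny h.1.2).elim]
  choose lo hi hle hlen hprop using harc
  have hfarprop := fun x hx => (hprop _ x hx rfl).1
  have hnearprop := fun x hx => (hprop _ x hx rfl).2
  have hfarnear : ∀ x ∈ X, ∀ y ∈ X, far x → ¬ far y → (∃ p : G.Walk x y, p.length ≤ d) →
      ∃ m, (N : ℤ) ∣ m ∧
        lo (H.connectedComponentMk y) + m - hi (H.connectedComponentMk x) ≤ d ∧
        lo (H.connectedComponentMk x) - (hi (H.connectedComponentMk y) + m) ≤ d := by
    rintro x hx y hy hfx hfy ⟨p, hp⟩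
    obtain ⟨i, ⟨q, hq⟩, h1, h2⟩ := hnearprop y hy hfy
    obtain ⟨c, hc, h3, h4⟩ := hfarprop x hx hfx i
      ⟨p.append q, by rw [Walk.length_append]; omega⟩
    exact ⟨c - i, (hg.eq_iff c i).1 hc, by omega, by omega⟩
  refine hg.exists_extension_of_arcs hd (fun x _ => hle (H.connectedComponentMk x)) ?_ ?_ ?_
    (ncard_biUnion_arcs_le hHX hle hlen)
  · rintro _ hx j rfl
    obtain ⟨i, hp, h1, h2⟩ := hnearprop _ hx fun hfar => hfar ⟨j, Walk.nil, by simp⟩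
    obtain ⟨p, hp⟩ := hp
    obtain ⟨j', hj', h⟩ := hg.geodesic i j (d / 2) ⟨p.reverse, by simpa using hp⟩
    rw [abs_le] at h
    exact ⟨j', hj', by omega, by omega⟩
  · rintro x hx c ⟨p, hp⟩
    by_cases hfar : far x
    · exact hfarprop x hx hfar c ⟨p, by omega⟩
    · obtain ⟨i, ⟨q, hq⟩, h1, h2⟩ := hnearprop x hx hfar
      obtain ⟨c', hc', h⟩ := hg.geodesic i c (d / 2 + d)
        ⟨q.reverse.append p, by rw [Walk.length_append, Walk.length_reverse]; omega⟩
      rw [abs_le] at h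
      exact ⟨c', hc', by omega, by omega⟩
  · intro x hx y hy hp
    by_cases hfx : far x <;> by_cases hfy : far y
    · have hxy : H.connectedComponentMk x = H.connectedComponentMk y := by
        by_cases h : x = y
        · rw [h]
        · exact ConnectedComponent.eq.2 (Adj.reachable ⟨h, ⟨hx, hfx⟩, ⟨hy, hfy⟩, hp⟩)
      have := hle (H.connectedComponentMk y)
      rw [hxy]
      exact ⟨0, dvd_zero _, by omega, by omega⟩
    · exact hfarnear x hx y hy hfx hfy hp
    · obtain ⟨p, hp⟩ := hp
      obtain ⟨m, hm, h1, h2⟩ := hfarnear y hy x hx hfy hfx ⟨p.reverse, by simpa using hp⟩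
      exact ⟨-m, (dvd_neg).2 hm, by omega, by omega⟩
    · obtain ⟨p, hp⟩ := hp
      obtain ⟨i, ⟨q, hq⟩, h1, h2⟩ := hnearprop x hx hfx
      obtain ⟨j, ⟨s, hs⟩, h3, h4⟩ := hnearprop y hy hfy
      obtain ⟨j', hj', h⟩ := hg.geodesic i j (d / 2 + (d + d / 2))
        ⟨q.reverse.append (p.append s), by
          rw [Walk.length_append, Walk.length_append, Walk.length_reverse]; omega⟩
      rw [abs_le] at h
      exact ⟨j' - j, (hg.eq_iff j' j).1 hj', by omega, by omega⟩

end IsGeodesicWinding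

theorem extend_separator
    {V : Type} [Fintype V] (G : SimpleGraph V) (d : ℕ) (hd : 0 < d)
    (X : Set V) (v : V) (c : G.Walk v v) (hc : c.IsCycle) (hgeo : IsGeodesic c) :
    ∃ R : Set (Set V),
      (∀ A ∈ R, ∀ B ∈ R, A ≠ B → Disjoint A B) ∧
      X ⊆ ⋃₀ R ∧
      ⋃₀ R ⊆ X ∪ {w : V | w ∈ c.support} ∧
      ((⋃₀ R) ∩ {w : V | w ∈ c.support}).ncard ≤ 2 * d * X.ncard ∧
      (∀ A ∈ R, A ∩ {w : V | w ∈ c.support} = ∅ ∨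
        ((SimpleGraph.fromEdgeSet {e : Sym2 V | e ∈ c.edges}).induce
          (A ∩ {w : V | w ∈ c.support})).Connected) ∧
      (∀ A ∈ R, ∀ B ∈ R, A ≠ B → ∀ x ∈ A, ∀ y ∈ B, ∀ p : G.Walk x y, d < p.length) := by
  obtain ⟨N, g, hg, hsupp⟩ := exists_geodesicWinding c hc hgeo
  obtain ⟨R, hR⟩ := hg.exists_extension hd X
  rw [hsupp]
  exact ⟨R, hR.disjoint, hR.subset_sUnion, hR.sUnion_subset, hR.ncard_le, hR.connected,
    hR.separated⟩
end

section
/- Let k and p be positive integers. Let G be a graph whose cycle space (over 𝔽₂) is generated by cycles of length at most p. If G contains a geodesic cycle of length at least k·p, then the tree-width of G is at least k. -/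
open SimpleGraph

/-- A tree-decomposition of a graph `G`. -/
structure TreeDecomp {V : Type u} (G : SimpleGraph V) : Type (u + 1) where
  ι : Type u
  T : SimpleGraph ι
  conn : T.Connected
  acyc : T.IsAcyclic
  bag : ι → Set V
  covers : ∀ v : V, ∃ i, v ∈ bag i
  coversEdges : ∀ ⦃x y : V⦄, G.Adj x y → ∃ i, x ∈ bag i ∧ y ∈ bag i
  coherent : ∀ (v : V) ⦃i j : ι⦄ (p : T.Walk i j), p.IsPath → v ∈ bag i → v ∈ bag j →
      ∀ k ∈ p.support, v ∈ bag k

/-- The width of a tree-decomposition: maximum bag size minus one. -/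
noncomputable def TreeDecomp.width {V : Type u} {G : SimpleGraph V} (td : TreeDecomp G) : ℕ :=
  (⨆ i, (td.bag i).ncard) - 1

/-- The tree-width of a graph: the minimum width of a tree-decomposition. -/
noncomputable def treewidth {V : Type u} (G : SimpleGraph V) : ℕ :=
  sInf {w | ∃ td : TreeDecomp G, td.width = w}

theorem SimpleGraph.Walk.sum_map_edges {V M : Type*} [AddCommMonoid M] {G : SimpleGraph V}
    {u v : V} (w : G.Walk u v) (g : Sym2 V → M) :
    (w.edges.map g).sum =
      ∑ i ∈ Finset.range w.length, g s(w.getVert i, w.getVert (i + 1)) := by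
  induction w with
  | nil => simp
  | cons h q ih =>
    rw [Walk.length_cons, Finset.sum_range_succ', Walk.edges_cons, List.map_cons, List.sum_cons,
      ih, add_comm]
    simp

theorem SimpleGraph.IsAcyclic.mem_support_of_dist_lt {ι : Type*} {T : SimpleGraph ι}
    (hconn : T.Connected) (hacyc : T.IsAcyclic) {t u a b : ι} (htu : T.Adj u t)
    (ha : T.dist u a < T.dist t a) (hb : T.dist t b ≤ T.dist u b) (w : T.Walk a b) :
    t ∈ w.support := by
  classical
  obtain ⟨p, hp⟩ := hconn.exists_walk_length_eq_dist u a
  obtain ⟨q, hq⟩ := hconn.exists_walk_length_eq_dist b t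
  have hbr := isBridge_iff_forall_walk_mem_edges.1
    (isAcyclic_iff_forall_adj_isBridge.1 hacyc htu) ((p.append w).append q)
  rw [Walk.edges_append, Walk.edges_append, List.mem_append, List.mem_append] at hbr
  rcases hbr with (h | h) | h
  · have ht := Walk.snd_mem_support_of_mem_edges _ h
    have h1 := dist_le (p.dropUntil t ht)
    have h2 := p.length_dropUntil_le_length ht
    omega
  · exact Walk.snd_mem_support_of_mem_edges _ h
  · have hu := Walk.fst_mem_support_of_mem_edges _ h
    have h1 := dist_le (q.takeUntil u hu)
    have h3 := congrArg Walk.length (q.take_spec hu)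
    rw [Walk.length_append] at h3
    have h4 : 0 < (q.dropUntil u hu).length := by
      have := hconn.pos_dist_of_ne htu.ne
      exact this.trans_le (dist_le _)
    rw [dist_comm] at h1
    rw [T.dist_comm (u := b)] at hq
    omega

/-- In a connected graph on `m` vertices, the perimeter of a triangle is at most `2 (m - 1)`. -/
theorem SimpleGraph.Reachable.perimeter_le {V : Type*} {R : SimpleGraph V} {Q : Finset V}
    {x y z : V} (hxy : R.Reachable x y) (hxz : R.Reachable x z)
    (hQ : ∀ w, R.Reachable x w → w ∈ Q) :
    R.dist x y + 1 ≤ Q.card ∧ R.dist x y + R.dist y z + R.dist x z + 2 ≤ 2 * Q.card := by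
  classical
  obtain ⟨p, hp, hpl⟩ := hxy.exists_path_of_dist
  obtain ⟨w, hw, hmin⟩ := Finset.exists_min_image p.support.toFinset (R.dist z)
    ⟨x, by simp⟩
  rw [List.mem_toFinset] at hw
  have hxw : R.Reachable x w := (p.takeUntil w hw).reachable
  obtain ⟨q, hq, hql⟩ := (hxz.symm.trans hxw).exists_path_of_dist
  have hdisj : ∀ a ∈ p.support, a ∈ q.support → a = w := by
    intro a hap haq
    have h1 := hmin a (by simpa using hap)
    have h2 := dist_le (q.takeUntil a haq)
    have h3 := congrArg Walk.length (q.take_spec haq)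
    rw [Walk.length_append] at h3
    exact Walk.eq_of_length_eq_zero (p := q.dropUntil a haq) (by omega)
  have hcard : (p.support.toFinset ∪ q.support.toFinset).card ≤ Q.card := by
    refine Finset.card_le_card fun a ha => hQ a ?_
    rw [Finset.mem_union, List.mem_toFinset, List.mem_toFinset] at ha
    rcases ha with h | h
    · exact (p.takeUntil a h).reachable
    · exact hxz.trans (q.takeUntil a h).reachable
  have hinter : (p.support.toFinset ∩ q.support.toFinset).card ≤ 1 := by
    refine Finset.card_le_one.2 fun a ha b hb => ?_
    simp only [Finset.mem_inter, List.mem_toFinset] at ha hb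
    rw [hdisj a ha.1 ha.2, hdisj b hb.1 hb.2]
  have hsum := Finset.card_union_add_card_inter p.support.toFinset q.support.toFinset
  rw [List.toFinset_card_of_nodup hp.support_nodup, List.toFinset_card_of_nodup hq.support_nodup,
    Walk.length_support, Walk.length_support] at hsum
  have h1 := dist_le ((p.takeUntil w hw).append q.reverse)
  have h2 := dist_le ((p.dropUntil w hw).reverse.append q.reverse)
  have h3 := congrArg Walk.length (p.take_spec hw)
  simp only [Walk.length_append, Walk.length_reverse] at h1 h2 h3
  omega

theorem SimpleGraph.Walk.exists_two_mul_length_le {V : Type*} {G : SimpleGraph V} {u x y : V}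
    (D : G.Walk u u) (hx : x ∈ D.support) (hy : y ∈ D.support) :
    ∃ w : G.Walk x y, 2 * w.length ≤ D.length := by
  classical
  have hy' : y ∈ (D.rotate x hx).support := by simpa using hy
  have h := congrArg Walk.length ((D.rotate x hx).take_spec hy')
  rw [Walk.length_append, Walk.length_rotate] at h
  by_cases hle : 2 * ((D.rotate x hx).takeUntil y hy').length ≤ D.length
  · exact ⟨_, hle⟩
  · exact ⟨((D.rotate x hx).dropUntil y hy').reverse, by rw [Walk.length_reverse]; omega⟩

theorem sum_eq_sum_of_mem_iff_odd {α κ : Type*} [Fintype α] [DecidableEq α] [Fintype κ]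
    {E : Finset α} {F : κ → Finset α}
    (h : ∀ e, e ∈ E ↔ Odd {i | e ∈ F i}.ncard) (g : α → ZMod 2) :
    ∑ e ∈ E, g e = ∑ i, ∑ e ∈ F i, g e := by
  classical
  have h1 : ∀ i, ∑ e ∈ F i, g e = ∑ e, if e ∈ F i then g e else 0 := fun i => by
    rw [← Finset.sum_filter, Finset.filter_univ_mem]
  simp_rw [h1]
  rw [Finset.sum_comm, ← Finset.filter_univ_mem E, Finset.sum_filter]
  refine Finset.sum_congr rfl fun e _ => ?_
  have h2 : {i | e ∈ F i}.ncard = (Finset.univ.filter fun i => e ∈ F i).card := by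
    rw [← Set.ncard_coe_finset]; simp
  rw [← Finset.sum_filter, Finset.sum_const, nsmul_eq_mul]
  have h3 := h e
  rw [h2] at h3
  split_ifs with he
  · rw [ZMod.natCast_eq_one_iff_odd.2 (h3.1 he), one_mul]
  · rw [ZMod.natCast_eq_zero_iff_even.2 (Nat.not_odd_iff_even.1 fun ho => he (h3.2 ho)), zero_mul]

/-- The contribution of the edge `e` to the number of pairs of a vertex in `Q` and an edge at it
satisfying `φ`, modulo two. -/
noncomputable def incidenceParity {V : Type*} (φ : Sym2 V → Prop) (Q : Finset V) (e : Sym2 V) :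
    ZMod 2 :=
  open Classical in if φ e then ∑ v ∈ Q, if v ∈ e then 1 else 0 else 0

theorem sum_incidenceParity_eq_zero {V : Type*} [Fintype V] [DecidableEq V] {G : SimpleGraph V}
    {φ : Sym2 V → Prop} {X Q : Finset V}
    (hφ : ∀ v e e', e ∈ G.edgeSet → e' ∈ G.edgeSet → v ∈ e → v ∈ e' → φ e → ¬ φ e' → v ∈ X)
    {u : V} {D : G.Walk u u} (hD : D.IsTrail)
    (hQ : ∀ x ∈ D.support, ∀ y ∈ D.support, x ∈ Q → y ∈ X → y ∈ Q) :
    ∑ e ∈ D.edges.toFinset, incidenceParity φ Q e = 0 := by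
  classical
  set δ : V → ZMod 2 := fun v => ∑ e ∈ D.edges.toFinset, if φ e ∧ v ∈ e then 1 else 0 with hδ
  have hsum : ∀ P : Finset V, ∑ e ∈ D.edges.toFinset, incidenceParity φ P e = ∑ v ∈ P, δ v := by
    intro P
    rw [hδ, Finset.sum_comm]
    refine Finset.sum_congr rfl fun e _ => ?_
    unfold incidenceParity
    split_ifs with he
    · simp only [he, true_and]
      exact Finset.sum_congr rfl fun _ _ => by congr
    · simp [he]
  have hsupp : ∀ v, v ∉ D.support → δ v = 0 := by
    intro v hv
    refine Finset.sum_eq_zero fun e he => if_neg fun hve => hv ?_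
    rw [List.mem_toFinset] at he
    exact Walk.mem_support_of_mem_edges he hve.2
  have hdeg : ∀ v, ∑ e ∈ D.edges.toFinset, (if v ∈ e then 1 else 0 : ZMod 2) = 0 := by
    intro v
    have h := (hD.even_countP_edges_iff v).2 (fun h => (h rfl).elim)
    rw [← ZMod.natCast_eq_zero_iff_even] at h
    refine Eq.trans ?_ h
    rw [Finset.sum_boole, List.countP_eq_length_filter,
      ← List.toFinset_card_of_nodup (hD.edges_nodup.filter _), List.toFinset_filter]
    simp
  have hX : ∀ v, v ∉ X → δ v = 0 := by
    intro v hv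
    by_cases hex : ∃ e ∈ D.edges, v ∈ e ∧ φ e
    · obtain ⟨e₀, he₀, hve₀, hφe₀⟩ := hex
      rw [← hdeg v]
      refine Finset.sum_congr rfl fun e he => ?_
      rw [List.mem_toFinset] at he
      by_cases hve : v ∈ e
      · have : φ e := by
          by_contra hn
          exact hv (hφ v e₀ e (D.edges_subset_edgeSet he₀) (D.edges_subset_edgeSet he)
            hve₀ hve hφe₀ hn)
        simp [hve, this]
      · simp [hve]
    · refine Finset.sum_eq_zero fun e he => if_neg fun hve => hex ?_
      exact ⟨e, by simpa using he, hve.2, hve.1⟩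
  rw [hsum]
  by_cases hne : ∃ x ∈ D.support, x ∈ Q
  · obtain ⟨x, hxD, hxQ⟩ := hne
    rw [Finset.sum_subset (Finset.subset_univ Q), ← hsum]
    · refine Finset.sum_eq_zero fun e he => ?_
      rw [List.mem_toFinset] at he
      have hes := D.edges_subset_edgeSet he
      induction e with | h a b =>
      have hab : a ≠ b := G.ne_of_adj hes
      unfold incidenceParity
      split_ifs
      · simp only [Sym2.mem_iff, Finset.sum_boole]
        have : (Finset.univ.filter fun v => v = a ∨ v = b) = {a, b} := by ext; simp
        rw [this, Finset.card_pair hab]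
        rfl
      · rfl
    · intro y _ hy
      by_cases hyD : y ∈ D.support
      · exact hX y fun hyX => hy (hQ x hxD y hyD hxQ hyX)
      · exact hsupp y hyD
  · exact Finset.sum_eq_zero fun v hv => hsupp v fun h => hne ⟨v, h, hv⟩

/-- Two vertices of `X` are adjacent when some walk of `G` of length at most `p / 2` joins them. -/
def SimpleGraph.proximityGraph {V : Type*} (G : SimpleGraph V) (X : Finset V) (p : ℕ) :
    SimpleGraph V where
  Adj x y := x ≠ y ∧ x ∈ X ∧ y ∈ X ∧ ∃ w : G.Walk x y, 2 * w.length ≤ p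
  symm := ⟨fun _ _ ⟨h, hx, hy, w, hw⟩ => ⟨h.symm, hy, hx, w.reverse, by simpa using hw⟩⟩
  loopless := ⟨fun _ h => h.1 rfl⟩

section proximityGraph

variable {V : Type*} {G : SimpleGraph V} {X : Finset V} {p : ℕ}

theorem SimpleGraph.proximityGraph_reachable_mem {x y : V}
    (h : (G.proximityGraph X p).Reachable x y) (hx : x ∈ X) : y ∈ X := by
  obtain ⟨w⟩ := h
  induction w with
  | nil => exact hx
  | cons hadj _ ih => exact ih hadj.2.2.1

theorem SimpleGraph.exists_walk_of_proximityGraph_reachable {x y : V}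
    (h : (G.proximityGraph X p).Reachable x y) :
    ∃ w : G.Walk x y, 2 * w.length ≤ (G.proximityGraph X p).dist x y * p := by
  obtain ⟨q, hq⟩ := h.exists_walk_length_eq_dist
  rw [← hq]
  clear hq
  induction q with
  | nil => exact ⟨Walk.nil, by simp⟩
  | cons hadj q ih =>
    obtain ⟨w, hw⟩ := ih ⟨q⟩
    obtain ⟨w', hw'⟩ := hadj.2.2.2
    refine ⟨w'.append w, ?_⟩
    rw [Walk.length_append, Walk.length_cons]
    linarith

variable {n : ℕ} {γ : ℤ → V}

/-- A component of the proximity graph on `m` vertices meets a geodesic cycle within an arc of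
length at most `(m - 1) p / 2`. -/
theorem exists_arc_of_proximityGraph_component
    (hγ : ∀ i j, γ i = γ j ↔ (n : ℤ) ∣ i - j)
    (hgeo : ∀ i j (w : G.Walk (γ i) (γ j)), ∃ j', γ j' = γ j ∧ (j' - i).natAbs ≤ w.length)
    {Q : Finset V} (hQ : ∀ x ∈ Q, ∀ y, (G.proximityGraph X p).Reachable x y ↔ y ∈ Q)
    (hn : (Q.card - 1) * p < n) :
    ∃ l : ℤ, ∀ t, γ t ∈ Q → ∃ j, (n : ℤ) ∣ j - t ∧ l ≤ j ∧ j ≤ l + ((Q.card - 1) * p / 2 : ℕ) := by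
  classical
  by_cases hex : ∃ i, γ i ∈ Q
  swap
  · exact ⟨0, fun t ht => (hex ⟨t, ht⟩).elim⟩
  obtain ⟨i₀, hi₀⟩ := hex
  have hlift : ∀ i j (w : G.Walk (γ i) (γ j)), (j - i).natAbs + w.length < n →
      (j - i).natAbs ≤ w.length := by
    intro i j w hw
    obtain ⟨j', hj', hle⟩ := hgeo i j w
    have h := Int.eq_zero_of_dvd_of_natAbs_lt_natAbs ((hγ _ _).1 hj') (by omega)
    omega
  have hclose : ∀ j j', γ j ∈ Q → γ j' ∈ Q → 2 * (j - i₀).natAbs ≤ (Q.card - 1) * p →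
      2 * (j' - i₀).natAbs ≤ (Q.card - 1) * p → 2 * (j' - j).natAbs ≤ (Q.card - 1) * p := by
    intro j j' hj hj' hd hd'
    have r := (hQ _ hi₀ _).2 hj
    have r' := (hQ _ hi₀ _).2 hj'
    have hmem : ∀ x ∈ Q, ∀ w, (G.proximityGraph X p).Reachable x w → w ∈ Q :=
      fun x hx w hw => (hQ x hx w).1 hw
    obtain ⟨h1, h2⟩ := r.perimeter_le r' (hmem _ hi₀)
    obtain ⟨h1', -⟩ := r'.perimeter_le r (hmem _ hi₀)
    obtain ⟨h1'', -⟩ := (r.symm.trans r').perimeter_le r.symm (hmem _ hj)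
    obtain ⟨a, ha⟩ := exists_walk_of_proximityGraph_reachable r
    obtain ⟨b, hb⟩ := exists_walk_of_proximityGraph_reachable (r.symm.trans r')
    obtain ⟨e, he⟩ := exists_walk_of_proximityGraph_reachable r'
    have m1 := Nat.mul_le_mul_right p (Nat.le_sub_of_add_le h1)
    have m1' := Nat.mul_le_mul_right p (Nat.le_sub_of_add_le h1')
    have m1'' := Nat.mul_le_mul_right p (Nat.le_sub_of_add_le h1'')
    have m2 := Nat.mul_le_mul_right p (Nat.le_sub_of_add_le h2)
    rw [show 2 * Q.card - 2 = 2 * (Q.card - 1) by omega, add_mul, add_mul, mul_assoc] at m2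
    have l1 := hlift _ _ a (by omega)
    have l2 := hlift _ _ e (by omega)
    have l3 := hlift _ _ b (by omega)
    omega
  obtain ⟨l, ⟨hlQ, hld⟩, hmin⟩ := Int.exists_least_of_bdd
    (P := fun j => γ j ∈ Q ∧ 2 * (j - i₀).natAbs ≤ (Q.card - 1) * p)
    ⟨i₀ - ((Q.card - 1) * p : ℕ), fun z hz => by have := hz.2; omega⟩ ⟨i₀, hi₀, by simp⟩
  refine ⟨l, fun t ht => ?_⟩
  have r := (hQ _ hi₀ _).2 ht
  obtain ⟨h1, -⟩ := r.perimeter_le r fun w hw => (hQ _ hi₀ w).1 hw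
  obtain ⟨a, ha⟩ := exists_walk_of_proximityGraph_reachable r
  obtain ⟨j, hj, hle⟩ := hgeo _ _ a
  have m1 := Nat.mul_le_mul_right p (Nat.le_sub_of_add_le h1)
  have hjQ : γ j ∈ Q := hj ▸ ht
  have hjd : 2 * (j - i₀).natAbs ≤ (Q.card - 1) * p := by omega
  have h2 := hmin j ⟨hjQ, hjd⟩
  have h3 := hclose l j hlQ hjQ hld hjd
  exact ⟨j, (hγ _ _).1 hj, h2, by omega⟩

theorem sum_Ioc_add_pred_eq (β : ℤ → ZMod 2) {t t' : ℕ} (h : t ≤ t') :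
    ∑ s ∈ Finset.Ioc t t', (β s + β (s - 1)) = β t' + β t := by
  induction t', h using Nat.le_induction with
  | base => simp [CharTwo.add_self_eq_zero]
  | succ m hm ih =>
    rw [Finset.sum_Ioc_succ_top (by omega), ih]
    push_cast
    rw [add_sub_cancel_right, add_add_add_comm, add_comm, ← add_assoc,
      add_comm (β t), add_assoc, add_assoc]
    have := CharTwo.add_self_eq_zero (β m)
    linear_combination this

/-- If an arc `[l, l + L]` avoids crossing `t` and `t'`, it lies on one side of them. -/
theorem arc_not_separated {n : ℕ} {l : ℤ} {L t t' s s' : ℕ} (hs' : s' < n) (hts : t < s)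
    (hst' : s ≤ t') (ht' : t' < n) (hout : s' ≤ t ∨ t' < s') {j j' : ℤ}
    (hj : (n : ℤ) ∣ j - s) (hj' : (n : ℤ) ∣ j' - s') (hl : l ≤ j) (hr : j ≤ l + L)
    (hl' : l ≤ j') (hr' : j' ≤ l + L)
    (hav : ∀ i, l ≤ i → i < l + L → (i % n).toNat ≠ t ∧ (i % n).toNat ≠ t') : False := by
  obtain ⟨a, ha⟩ := hj
  obtain ⟨b, hb⟩ := hj'
  have hmod : ∀ (x : ℕ) (c : ℤ), x < n → ((x + n * c) % n).toNat = x := by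
    intro x c hx
    rw [Int.add_mul_emod_self_left, Int.emod_eq_of_lt (by omega) (by omega)]
    simp
  have key : ∀ (x : ℕ) (c : ℤ), x < n → l ≤ x + n * c → x + n * c < l + L → x ≠ t ∧ x ≠ t' := by
    intro x c hx h1 h2
    have := hav _ h1 h2
    rwa [hmod x c hx] at this
  rcases lt_trichotomy a b with hab | hab | hab
  · have : (n : ℤ) * (a + 1) ≤ n * b := by gcongr; omega
    have h := key t' a ht' (by linarith) (by nlinarith)
    exact h.2 rfl
  · subst hab
    rcases hout with h | h
    · exact (key t a (by omega) (by linarith) (by linarith)).1 rfl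
    · exact (key t' a ht' (by linarith) (by linarith)).2 rfl
  · have : (n : ℤ) * (b + 1) ≤ n * a := by gcongr; omega
    exact (key t a (by omega) (by nlinarith) (by linarith)).1 rfl

/-- If `X` has at most `k` vertices, then outside a minority `H` of the edges of a long geodesic
cycle, every edge labelling is constant that changes only at vertices of `X`, and changes an even
number of times in each component of the proximity graph. -/
theorem exists_exceptional_set {k : ℕ} (hp : 0 < p) (hn0 : 0 < n) (hX : X.card ≤ k)
    (hkn : k * p ≤ n) (hγ : ∀ i j, γ i = γ j ↔ (n : ℤ) ∣ i - j)
    (hgeo : ∀ i j (w : G.Walk (γ i) (γ j)), ∃ j', γ j' = γ j ∧ (j' - i).natAbs ≤ w.length) :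
    ∃ H ⊆ Finset.range n, 2 * H.card ≤ (k - 1) * p ∧ ∀ β : ℤ → ZMod 2,
      (∀ i, γ i ∉ X → β i = β (i - 1)) →
      (∀ Q ⊆ X, (∀ x ∈ Q, ∀ y, (G.proximityGraph X p).Reachable x y → y ∈ Q) →
        open Classical in
        ∑ s ∈ Finset.range n, (if γ s ∈ Q then β s + β (s - 1) else 0) = 0) →
      ∀ t < n, ∀ t' < n, t ∉ H → t' ∉ H → β t = β t' := by
  classical
  set R := G.proximityGraph X p
  set B := X.image R.connectedComponentMk
  set Q : R.ConnectedComponent → Finset V := fun b => X.filter fun a => R.connectedComponentMk a = b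
    with hQdef
  have hQ : ∀ b, ∀ x ∈ Q b, ∀ y, R.Reachable x y ↔ y ∈ Q b := by
    intro b x hx y
    simp only [hQdef, Finset.mem_filter] at hx ⊢
    rw [← hx.2, ConnectedComponent.eq]
    exact ⟨fun h => ⟨proximityGraph_reachable_mem h hx.1, h.symm⟩, fun h => h.2.symm⟩
  have hsub : ∀ b, Q b ⊆ X := fun b => Finset.filter_subset _ _
  have hcard : ∀ b, (Q b).card ≤ k := fun b => (Finset.card_le_card (hsub b)).trans hX
  have hlt : ∀ b, ((Q b).card - 1) * p < n := by
    intro b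
    rcases Nat.eq_zero_or_pos ((Q b).card - 1) with h | h
    · rwa [h, zero_mul]
    · refine lt_of_lt_of_le (Nat.mul_lt_mul_of_pos_right ?_ hp) hkn
      have := hcard b
      omega
  choose l hl using fun b => exists_arc_of_proximityGraph_component hγ hgeo (hQ b) (hlt b)
  set L : R.ConnectedComponent → ℕ := fun b => ((Q b).card - 1) * p / 2 with hL
  set A : R.ConnectedComponent → Finset ℕ := fun b =>
    (Finset.Ico (l b) (l b + L b)).image fun i : ℤ => (i % n).toNat with hA
  refine ⟨B.biUnion A, ?_, ?_, ?_⟩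
  · intro t ht
    simp only [hA, Finset.mem_biUnion, Finset.mem_image] at ht
    obtain ⟨_, _, i, _, rfl⟩ := ht
    have h1 := Int.emod_nonneg i (show (n : ℤ) ≠ 0 by omega)
    have h2 := Int.emod_lt_of_pos i (show (0 : ℤ) < n by omega)
    rw [Finset.mem_range]
    omega
  · have h1 : ∀ b ∈ B, 2 * (A b).card ≤ ((Q b).card - 1) * p := by
      intro b _
      have : (A b).card ≤ L b := Finset.card_image_le.trans (by simp)
      simp only [hL] at this
      omega
    have h2 : ∀ b ∈ B, 1 ≤ (Q b).card := by
      intro b hb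
      obtain ⟨x, hx, rfl⟩ := Finset.mem_image.1 hb
      exact Finset.card_pos.2 ⟨x, by simp [hQdef, hx]⟩
    have h3 : X.card = ∑ b ∈ B, (Q b).card := Finset.card_eq_sum_card_image _ _
    have h4 : ∑ b ∈ B, ((Q b).card - 1) + B.card = X.card := by
      rw [h3, Finset.card_eq_sum_ones, ← Finset.sum_add_distrib]
      exact Finset.sum_congr rfl fun b hb => Nat.sub_add_cancel (h2 b hb)
    have h5 : ∑ b ∈ B, ((Q b).card - 1) ≤ k - 1 := by
      rcases B.eq_empty_or_nonempty with h | h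
      · simp [h]
      · have := h.card_pos
        omega
    calc 2 * (B.biUnion A).card ≤ 2 * ∑ b ∈ B, (A b).card := by
          gcongr; exact Finset.card_biUnion_le
      _ = ∑ b ∈ B, 2 * (A b).card := Finset.mul_sum _ _ _
      _ ≤ ∑ b ∈ B, ((Q b).card - 1) * p := Finset.sum_le_sum h1
      _ = (∑ b ∈ B, ((Q b).card - 1)) * p := (Finset.sum_mul _ _ _).symm
      _ ≤ (k - 1) * p := by gcongr
  · intro β hβ hpar
    have main : ∀ t t', t < t' → t' < n → t ∉ B.biUnion A → t' ∉ B.biUnion A → β t = β t' := by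
      intro t t' htt' ht' hnt hnt'
      suffices h : ∑ s ∈ Finset.Ioc t t', (β s + β (s - 1)) = 0 by
        rw [sum_Ioc_add_pred_eq β htt'.le, CharTwo.add_eq_zero] at h
        exact h.symm
      have hout : ∀ s ∈ Finset.Ioc t t', s ∉ (Finset.Ioc t t').filter (fun s : ℕ => γ s ∈ X) →
          β s + β (s - 1) = 0 := by
        intro s hs hs'
        rw [hβ s fun h => hs' (Finset.mem_filter.2 ⟨hs, h⟩)]
        exact CharTwo.add_self_eq_zero _
      rw [← Finset.sum_subset (Finset.filter_subset _ _) hout,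
        ← Finset.sum_fiberwise_of_maps_to (t := B) (g := fun s : ℕ => R.connectedComponentMk (γ s))
          fun s hs => Finset.mem_image_of_mem _ (Finset.mem_filter.1 hs).2]
      refine Finset.sum_eq_zero fun b hb => ?_
      rw [Finset.filter_filter]
      have hmemQ : ∀ s : ℕ, γ s ∈ X ∧ R.connectedComponentMk (γ s) = b ↔ γ s ∈ Q b := by
        intro s
        simp [hQdef]
      simp_rw [hmemQ]
      by_cases hin : ∃ s ∈ Finset.Ioc t t', γ (s : ℕ) ∈ Q b
      · obtain ⟨s, hs, hsQ⟩ := hin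
        rw [← hpar (Q b) (hsub b) fun x hx y hy => (hQ b x hx y).1 hy, ← Finset.sum_filter]
        refine Finset.sum_congr ?_ fun _ _ => rfl
        ext s'
        simp only [Finset.mem_filter, Finset.mem_Ioc, Finset.mem_range] at hs ⊢
        refine and_congr_left fun hs'Q => ⟨fun h => by omega, fun h => ?_⟩
        by_contra hc
        obtain ⟨j, hj, hlj, hjr⟩ := hl b s hsQ
        obtain ⟨j', hj', hlj', hjr'⟩ := hl b s' hs'Q
        refine arc_not_separated (L := L b) h hs.1 hs.2 ht' (by omega) hj hj' hlj hjr hlj' hjr' ?_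
        intro i hi hi'
        have hiA : (i % n).toNat ∈ B.biUnion A :=
          Finset.mem_biUnion.2 ⟨b, hb, Finset.mem_image_of_mem _ (Finset.mem_Ico.2 ⟨hi, hi'⟩)⟩
        exact ⟨fun he => hnt (he ▸ hiA), fun he => hnt' (he ▸ hiA)⟩
      · exact Finset.sum_eq_zero fun s hs =>
          (hin ⟨s, (Finset.mem_filter.1 hs).1, (Finset.mem_filter.1 hs).2⟩).elim
    intro t ht t' ht' hnt hnt'
    rcases lt_trichotomy t t' with h | h | h
    · exact main t t' h ht' hnt hnt'
    · rw [h]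
    · exact (main t' t h ht hnt' hnt).symm

end proximityGraph

/-- The `i`-th vertex of a closed walk, with indices read modulo its length. -/
def SimpleGraph.Walk.cyclicVert {V : Type*} {G : SimpleGraph V} {v : V} (c : G.Walk v v) (i : ℤ) :
    V :=
  c.getVert (i % c.length).toNat

section cyclicVert

variable {V : Type*} {G : SimpleGraph V} {v : V} {c : G.Walk v v}

theorem SimpleGraph.Walk.cyclicVert_natCast {s : ℕ} (hs : s ≤ c.length) :
    c.cyclicVert s = c.getVert s := by
  unfold Walk.cyclicVert
  rcases hs.lt_or_eq with h | rfl
  · rw [← Int.natCast_mod, Int.toNat_natCast, Nat.mod_eq_of_lt h]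
  · simp

theorem SimpleGraph.Walk.IsCycle.cyclicVert_eq_iff (hc : c.IsCycle) (i j : ℤ) :
    c.cyclicVert i = c.cyclicVert j ↔ (c.length : ℤ) ∣ i - j := by
  have h3 := hc.three_le_length
  have hi := Int.emod_nonneg i (show (c.length : ℤ) ≠ 0 by omega)
  have hi' := Int.emod_lt_of_pos i (show (0 : ℤ) < c.length by omega)
  have hj := Int.emod_nonneg j (show (c.length : ℤ) ≠ 0 by omega)
  have hj' := Int.emod_lt_of_pos j (show (0 : ℤ) < c.length by omega)
  rw [Int.dvd_iff_emod_eq_zero, ← Int.emod_eq_emod_iff_emod_sub_eq_zero]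
  refine ⟨fun h => ?_, fun h => by unfold Walk.cyclicVert; rw [h]⟩
  have := hc.getVert_injOn' (show (i % c.length).toNat ≤ c.length - 1 by omega)
    (show (j % c.length).toNat ≤ c.length - 1 by omega) h
  omega

theorem SimpleGraph.Walk.IsCycle.cyclicVert_add_length (hc : c.IsCycle) (i : ℤ) :
    c.cyclicVert (i + c.length) = c.cyclicVert i :=
  (hc.cyclicVert_eq_iff _ _).2 (by simp)

theorem SimpleGraph.Walk.IsCycle.adj_cyclicVert (hc : c.IsCycle) (i : ℤ) :
    G.Adj (c.cyclicVert i) (c.cyclicVert (i + 1)) := by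
  have h3 := hc.three_le_length
  have hi := Int.emod_nonneg i (show (c.length : ℤ) ≠ 0 by omega)
  have hi' := Int.emod_lt_of_pos i (show (0 : ℤ) < c.length by omega)
  have h1 : c.cyclicVert (i + 1) = c.cyclicVert ((i % c.length).toNat + 1 : ℕ) := by
    rw [hc.cyclicVert_eq_iff]
    push_cast
    rw [Int.toNat_of_nonneg hi, add_sub_add_right_eq_sub]
    exact Int.dvd_self_sub_emod
  rw [h1, Walk.cyclicVert_natCast (by omega)]
  exact c.adj_getVert_succ (by omega)

theorem SimpleGraph.Walk.exists_cyclicVert_of_mem_edges {e : Sym2 V} (he : e ∈ c.edges) :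
    ∃ i : ℤ, e = s(c.cyclicVert i, c.cyclicVert (i + 1)) := by
  obtain ⟨i, hi, rfl⟩ := List.mem_iff_getElem.1 he
  rw [Walk.length_edges] at hi
  refine ⟨i, ?_⟩
  have h := Walk.cyclicVert_natCast (c := c) (s := i + 1) (by omega)
  push_cast at h
  rw [h, Walk.cyclicVert_natCast hi.le, Walk.getElem_edges]

theorem SimpleGraph.Walk.IsCycle.exists_lift (hc : c.IsCycle) {x y : V} (w : G.Walk x y)
    (hw : ∀ e ∈ w.edges, e ∈ c.edges) (i : ℤ) (hi : c.cyclicVert i = x) :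
    ∃ j, c.cyclicVert j = y ∧ (j - i).natAbs ≤ w.length := by
  induction w generalizing i with
  | nil => exact ⟨i, hi, by simp⟩
  | @cons a b d h q ih =>
    obtain ⟨m, hm⟩ := Walk.exists_cyclicVert_of_mem_edges (hw s(a, b) (by simp))
    have hstep : ∃ j, c.cyclicVert j = b ∧ (j - i).natAbs ≤ 1 := by
      rw [Sym2.eq_iff] at hm
      rcases hm with ⟨h1, h2⟩ | ⟨h1, h2⟩
      · refine ⟨i + 1, ?_, by omega⟩
        rw [h2, hc.cyclicVert_eq_iff, add_sub_add_right_eq_sub, ← hc.cyclicVert_eq_iff, hi, h1]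
      · refine ⟨i - 1, ?_, by omega⟩
        rw [h2, hc.cyclicVert_eq_iff, sub_sub, add_comm 1, ← hc.cyclicVert_eq_iff, hi, h1]
    obtain ⟨j, hj, hji⟩ := hstep
    obtain ⟨j', hj', hle⟩ := ih (fun e he => hw e (by simp [he])) j hj
    refine ⟨j', hj', ?_⟩
    rw [Walk.length_cons]
    omega

theorem SimpleGraph.Walk.cyclicVert_mem_support (i : ℤ) : c.cyclicVert i ∈ c.support :=
  c.getVert_mem_support _

/-- Counting the pairs of a vertex in `Q` and an edge of the cycle by vertices or by edges. -/
theorem SimpleGraph.Walk.IsCycle.sum_boundary_eq [DecidableEq V] (hc : c.IsCycle)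
    (φ : Sym2 V → Prop) [DecidablePred φ] (Q : Finset V) (β : ℤ → ZMod 2)
    (hβ : ∀ i, β i = if φ s(c.cyclicVert i, c.cyclicVert (i + 1)) then 1 else 0) :
    ∑ s ∈ Finset.range c.length, (if c.cyclicVert s ∈ Q then β s + β (s - 1) else 0) =
      ∑ e ∈ c.edges.toFinset, incidenceParity φ Q e := by
  classical
  rw [List.sum_toFinset _ hc.isTrail.edges_nodup, Walk.sum_map_edges]
  set q : ℤ → ZMod 2 := fun i => if c.cyclicVert i ∈ Q then 1 else 0 with hq
  have h1 : ∀ s ∈ Finset.range c.length, incidenceParity φ Q s(c.getVert s, c.getVert (s + 1)) =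
      β s * q s + β s * q (s + 1) := by
    intro s hs
    rw [Finset.mem_range] at hs
    have hs1 := Walk.cyclicVert_natCast (c := c) (s := s + 1) (by omega)
    have hs0 := Walk.cyclicVert_natCast (c := c) hs.le
    push_cast at hs1
    have hne := (hc.adj_cyclicVert s).ne
    rw [← hs0, ← hs1, hβ, ← mul_add]
    unfold incidenceParity
    split_ifs with h
    · rw [one_mul, hq]
      have : ∀ v, (if v ∈ s(c.cyclicVert s, c.cyclicVert (s + 1)) then 1 else 0 : ZMod 2) =
          (if v = c.cyclicVert s then 1 else 0) + if v = c.cyclicVert (s + 1) then 1 else 0 := by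
        intro v
        by_cases ha : v = c.cyclicVert s
        · simp [ha, hne]
        · simp [ha]
      refine (Finset.sum_congr rfl fun v _ => Eq.trans (by congr) (this v)).trans ?_
      rw [Finset.sum_add_distrib]
      simp
    · rw [zero_mul]
  have h2 : ∀ s ∈ Finset.range c.length,
      (if c.cyclicVert s ∈ Q then β s + β (s - 1) else 0) = β s * q s + β (s - 1) * q s := by
    intro s _
    simp only [hq]
    split_ifs <;> simp
  have hper : ∀ i, β (i + c.length) = β i := by
    intro i
    rw [hβ, hβ, add_right_comm, hc.cyclicVert_add_length, hc.cyclicVert_add_length]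
  have hshift : ∑ s ∈ Finset.range c.length, β s * q (s + 1) =
      ∑ s ∈ Finset.range c.length, β (s - 1) * q s := by
    have e1 := Finset.sum_range_succ (fun s : ℕ => β (s - 1) * q s) c.length
    have e2 := Finset.sum_range_succ' (fun s : ℕ => β (s - 1) * q s) c.length
    have e3 : β ((c.length : ℕ) - 1) * q (c.length : ℕ) = β ((0 : ℕ) - 1) * q (0 : ℕ) := by
      have a1 := hper (-1)
      have a2 := hc.cyclicVert_add_length 0
      rw [neg_add_eq_sub] at a1
      rw [zero_add] at a2
      simp only [hq, a1, a2, Nat.cast_zero, zero_sub]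
    rw [e1, e3] at e2
    have e4 := add_right_cancel e2
    rw [e4]
    simp
  rw [Finset.sum_congr rfl h1, Finset.sum_congr rfl h2, Finset.sum_add_distrib,
    Finset.sum_add_distrib, hshift]

end cyclicVert

theorem SimpleGraph.Connected.exists_adj_dist_lt {ι : Type*} {T : SimpleGraph ι}
    (hT : T.Connected) {a b : ι} (hab : a ≠ b) : ∃ u, T.Adj u a ∧ T.dist u b < T.dist a b := by
  obtain ⟨w, hw⟩ := hT.exists_walk_length_eq_dist a b
  cases w with
  | nil => exact (hab rfl).elim
  | cons h q =>
    refine ⟨_, h.symm, ?_⟩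
    have := dist_le q
    rw [Walk.length_cons] at hw
    omega

theorem IsGeodesic.exists_lift {V : Type*} {G : SimpleGraph V} {v : V} {c : G.Walk v v}
    (hgeo : IsGeodesic c) (hc : c.IsCycle) (i j : ℤ)
    (w : G.Walk (c.cyclicVert i) (c.cyclicVert j)) :
    ∃ j', c.cyclicVert j' = c.cyclicVert j ∧ (j' - i).natAbs ≤ w.length := by
  classical
  obtain ⟨q, -, hqc, hmin⟩ :=
    hgeo _ (Walk.cyclicVert_mem_support i) _ (Walk.cyclicVert_mem_support j)
  obtain ⟨j', hj', hle⟩ := hc.exists_lift q hqc i rfl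
  exact ⟨j', hj', hle.trans ((hmin _ w.bypass_isPath).trans w.length_bypass_le_length)⟩

/-- In a decomposition into bags of size at most `k`, all but a minority of the edges of the long
geodesic cycle agree on every property of edges that can only change at vertices of a given bag. -/
theorem exists_exceptional_set_of_isGeodesic {V : Type} [Fintype V] {G : SimpleGraph V} {k p : ℕ}
    (hp : 0 < p)
    (hgen : ∀ (w : V) (c : G.Walk w w), c.IsCycle →
      ∃ (ι : Type) (_ : Fintype ι) (u : ι → V) (D : ∀ i, G.Walk (u i) (u i)),
        (∀ i, (D i).IsCycle) ∧ (∀ i, (D i).length ≤ p) ∧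
        ∀ e : Sym2 V, e ∈ c.edges ↔ Odd {i : ι | e ∈ (D i).edges}.ncard)
    {v : V} {c : G.Walk v v} (hc : c.IsCycle) (hgeo : IsGeodesic c) (hlen : k * p ≤ c.length)
    {X : Finset V} (hX : X.card ≤ k) :
    ∃ H ⊆ Finset.range c.length, 2 * H.card ≤ (k - 1) * p ∧ ∀ φ : Sym2 V → Prop,
      (∀ v e e', e ∈ G.edgeSet → e' ∈ G.edgeSet → v ∈ e → v ∈ e' → φ e → ¬ φ e' → v ∈ X) →
      ∀ t < c.length, ∀ t' < c.length, t ∉ H → t' ∉ H →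
        φ s(c.cyclicVert t, c.cyclicVert (t + 1)) →
        φ s(c.cyclicVert t', c.cyclicVert (t' + 1)) := by
  classical
  obtain ⟨H, hHn, hH, hconst⟩ := exists_exceptional_set hp
    (by have := hc.three_le_length; omega) hX hlen hc.cyclicVert_eq_iff (hgeo.exists_lift hc)
  refine ⟨H, hHn, hH, fun φ hφ t ht t' ht' hnt hnt' hφt => ?_⟩
  set β : ℤ → ZMod 2 := fun i => if φ s(c.cyclicVert i, c.cyclicVert (i + 1)) then 1 else 0 with hβ
  have hmain := hconst β ?_ ?_ t ht t' ht' hnt hnt'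
  · by_contra hn
    simp [hβ, hφt, hn] at hmain
  · intro i hi
    have e1 : s(c.cyclicVert i, c.cyclicVert (i + 1)) ∈ G.edgeSet := hc.adj_cyclicVert i
    have e2 : s(c.cyclicVert (i - 1), c.cyclicVert (i - 1 + 1)) ∈ G.edgeSet :=
      hc.adj_cyclicVert (i - 1)
    have m1 : c.cyclicVert i ∈ s(c.cyclicVert i, c.cyclicVert (i + 1)) := Sym2.mem_mk_left _ _
    have m2 : c.cyclicVert i ∈ s(c.cyclicVert (i - 1), c.cyclicVert (i - 1 + 1)) := by simp
    have : φ s(c.cyclicVert i, c.cyclicVert (i + 1)) ↔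
        φ s(c.cyclicVert (i - 1), c.cyclicVert (i - 1 + 1)) := by
      constructor
      · intro h
        by_contra h'
        exact hi (hφ _ _ _ e1 e2 m1 m2 h h')
      · intro h
        by_contra h'
        exact hi (hφ _ _ _ e2 e1 m2 m1 h h')
    simp only [hβ, this]
  · intro Q hQX hQ
    obtain ⟨κ, _, u, D, hD, hDp, hodd⟩ := hgen v c hc
    have hsum := hc.sum_boundary_eq φ Q β fun _ => rfl
    have hodd' : ∀ e, e ∈ c.edges.toFinset ↔ Odd {i | e ∈ (D i).edges.toFinset}.ncard := by
      simpa using hodd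
    rw [sum_eq_sum_of_mem_iff_odd hodd' (incidenceParity φ Q)] at hsum
    refine Eq.trans ?_ (hsum.trans (Finset.sum_eq_zero fun i _ => ?_))
    · refine Finset.sum_congr rfl fun s _ => ?_
      congr
    · refine sum_incidenceParity_eq_zero hφ (hD i).isTrail fun x hx y hy hxQ hyX => ?_
      by_cases hxy : x = y
      · exact hxy ▸ hxQ
      obtain ⟨w, hw⟩ := (D i).exists_two_mul_length_le hx hy
      have hadj : (G.proximityGraph X p).Adj x y :=
        ⟨hxy, hQX hxQ, hyX, w, hw.trans (hDp i)⟩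
      exact hQ x hxQ y hadj.reachable

/-- Every tree-decomposition has a bag with more than `k` vertices: otherwise the node minimizing
the total distance to the edges of the cycle could be moved towards most of them. -/
theorem TreeDecomp.exists_lt_ncard_bag {V : Type} [Fintype V] {G : SimpleGraph V} {k p : ℕ}
    (hk : 0 < k) (hp : 0 < p)
    (hgen : ∀ (w : V) (c : G.Walk w w), c.IsCycle →
      ∃ (ι : Type) (_ : Fintype ι) (u : ι → V) (D : ∀ i, G.Walk (u i) (u i)),
        (∀ i, (D i).IsCycle) ∧ (∀ i, (D i).length ≤ p) ∧
        ∀ e : Sym2 V, e ∈ c.edges ↔ Odd {i : ι | e ∈ (D i).edges}.ncard)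
    {v : V} {c : G.Walk v v} (hc : c.IsCycle) (hgeo : IsGeodesic c) (hlen : k * p ≤ c.length)
    (td : TreeDecomp G) : ∃ t, k < (td.bag t).ncard := by
  classical
  by_contra! hbag
  have h3 := hc.three_le_length
  have hp3 : 3 ≤ p := by
    obtain ⟨κ, _, u, D, hD, hDp, hodd⟩ := hgen v c hc
    obtain ⟨e, he⟩ := List.exists_mem_of_length_pos (l := c.edges)
      (by rw [Walk.length_edges]; omega)
    obtain ⟨i, -⟩ := Set.nonempty_of_ncard_ne_zero ((hodd e).1 he).pos.ne'
    exact (hD i).three_le_length.trans (hDp i)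
  have hne : Nonempty td.ι := td.conn.nonempty
  have hf : ∀ e : Sym2 V, ∃ i, e ∈ G.edgeSet → ∀ x ∈ e, x ∈ td.bag i := by
    intro e
    by_cases he : e ∈ G.edgeSet
    · induction e with | h a b =>
      obtain ⟨i, ha, hb⟩ := td.coversEdges he
      refine ⟨i, fun _ x hx => ?_⟩
      rcases Sym2.mem_iff.1 hx with rfl | rfl <;> assumption
    · exact ⟨Classical.arbitrary _, fun h => (he h).elim⟩
  choose f hf using hf
  set ε : ℕ → Sym2 V := fun s => s(c.cyclicVert s, c.cyclicVert (s + 1)) with hε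
  have hεG : ∀ s, ε s ∈ G.edgeSet := fun s => hc.adj_cyclicVert s
  set Φ : td.ι → ℕ := fun t => ∑ s ∈ Finset.range c.length, td.T.dist t (f (ε s)) with hΦ
  obtain ⟨t, ht⟩ : ∃ t, ∀ u, Φ t ≤ Φ u :=
    ⟨Function.argmin Φ, fun u => Function.argmin_le Φ u⟩
  set X := (td.bag t).toFinset with hXdef
  have hX : X.card ≤ k := by
    rw [hXdef, ← Set.ncard_eq_toFinset_card']
    exact hbag t
  obtain ⟨H, hHn, hH, hconst⟩ :=
    exists_exceptional_set_of_isGeodesic hp hgen hc hgeo hlen hX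
  have hHc : (Finset.range c.length \ H).card + H.card = c.length := by
    rw [Finset.card_sdiff_add_card_eq_card hHn, Finset.card_range]
  have hk1 : (k - 1) * p + p = k * p := by
    rw [← Nat.succ_mul, Nat.succ_eq_add_one, Nat.sub_add_cancel hk]
  obtain ⟨s₀, hs₀, hs₀H, hs₀t⟩ : ∃ s < c.length, s ∉ H ∧ t ≠ f (ε s) := by
    by_contra! hall
    have hle : (Finset.range c.length \ H).card ≤ X.card := by
      refine Finset.card_le_card_of_injOn (fun s : ℕ => c.cyclicVert s) ?_ ?_
      · intro s hs
        simp only [Finset.coe_sdiff, Set.mem_sdiff, Finset.mem_coe, Finset.mem_range] at hs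
        have := hf (ε s) (hεG s) (c.cyclicVert s) (Sym2.mem_mk_left _ _)
        rw [← hall s hs.1 hs.2] at this
        simpa [hXdef] using this
      · intro s hs s' hs' h
        simp only [Finset.coe_sdiff, Set.mem_sdiff, Finset.mem_coe, Finset.mem_range] at hs hs'
        have h := Int.eq_zero_of_dvd_of_natAbs_lt_natAbs ((hc.cyclicVert_eq_iff _ _).1 h)
          (by omega)
        omega
    have : k * 3 ≤ k * p := Nat.mul_le_mul_left k hp3
    omega
  obtain ⟨u, hut, hu⟩ := td.conn.exists_adj_dist_lt hs₀t
  have hcloser : ∀ s < c.length, s ∉ H → td.T.dist u (f (ε s)) < td.T.dist t (f (ε s)) := by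
    intro s hs hsH
    refine hconst (fun e => td.T.dist u (f e) < td.T.dist t (f e)) ?_ s₀ hs₀ s hs hs₀H hsH hu
    intro x e e' he he' hxe hxe' hlt hnlt
    obtain ⟨w, hw⟩ := td.conn.exists_isPath (f e) (f e')
    have htw := td.acyc.mem_support_of_dist_lt td.conn hut hlt (not_lt.1 hnlt) w
    have := td.coherent x w hw (hf e he x hxe) (hf e' he' x hxe') t htw
    simpa [hXdef] using this
  have hstep : Φ u + (Finset.range c.length \ H).card ≤ Φ t + H.card := by
    have e1 : (Finset.range c.length \ H).card =
        ∑ s ∈ Finset.range c.length, if s ∈ H then 0 else 1 := by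
      rw [Finset.card_eq_sum_ones, Finset.sdiff_eq_filter, Finset.sum_filter]
      exact Finset.sum_congr rfl fun s _ => by split_ifs <;> simp_all
    have e2 : H.card = ∑ s ∈ Finset.range c.length, if s ∈ H then 1 else 0 := by
      rw [Finset.sum_boole, Finset.filter_mem_eq_inter, Finset.inter_eq_right.2 hHn, Nat.cast_id]
    rw [e1, e2, hΦ, ← Finset.sum_add_distrib, ← Finset.sum_add_distrib]
    refine Finset.sum_le_sum fun s hs => ?_
    split_ifs with h
    · have := td.conn.dist_triangle (u := u) (v := t) (w := f (ε s))
      rw [dist_eq_one_iff_adj.2 hut] at this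
      omega
    · have := hcloser s (Finset.mem_range.1 hs) h
      omega
  have := ht u
  omega

/-- The tree-decomposition with a single bag. -/
def TreeDecomp.single {V : Type u} (G : SimpleGraph V) : TreeDecomp G where
  ι := PUnit
  T := ⊥
  conn := { preconnected := Preconnected.of_subsingleton, nonempty := inferInstance }
  acyc := isAcyclic_bot
  bag _ := Set.univ
  covers _ := ⟨PUnit.unit, trivial⟩
  coversEdges _ _ _ := ⟨PUnit.unit, trivial, trivial⟩
  coherent _ _ _ _ _ _ _ _ _ := trivial

theorem treewidth_ge_of_cycle_space_generated_by_short_cycles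
    {V : Type} [Fintype V] (G : SimpleGraph V) (k p : ℕ) (hk : 0 < k) (hp : 0 < p)
    (hgen : ∀ (w : V) (c : G.Walk w w), c.IsCycle →
      ∃ (ι : Type) (_ : Fintype ι) (u : ι → V) (D : ∀ i, G.Walk (u i) (u i)),
        (∀ i, (D i).IsCycle) ∧ (∀ i, (D i).length ≤ p) ∧
        ∀ e : Sym2 V, e ∈ c.edges ↔ Odd {i : ι | e ∈ (D i).edges}.ncard)
    (v : V) (c : G.Walk v v) (hc : c.IsCycle) (hgeo : IsGeodesic c)
    (hlen : k * p ≤ c.length) :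
    k ≤ treewidth G := by
  obtain ⟨td, htd⟩ := Nat.sInf_mem (s := {w | ∃ td : TreeDecomp G, td.width = w})
    ⟨_, TreeDecomp.single G, rfl⟩
  obtain ⟨t, ht⟩ := td.exists_lt_ncard_bag hk hp hgen hc hgeo hlen
  have hbdd : BddAbove (Set.range fun i => (td.bag i).ncard) :=
    ⟨Nat.card V, by rintro _ ⟨i, rfl⟩; exact Set.ncard_le_card _⟩
  have hle := le_ciSup hbdd t
  change _ = treewidth G at htd
  rw [← htd, TreeDecomp.width]
  omega
end
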